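/- Let a, b > 6 and define T(x,y) := (a√x − ⌊a√x⌋, by + √x − ⌊by + √x⌋) on Ω := {(x,y) ∈ (0,1)² : a√x ∉ ℤ and by + √x ∉ ℤ}, where ⌊c⌋ denotes the integer part of c. Then T admits a T-invariant probability measure absolutely continuous with respect to two-dimensional Lebesgue measure m, whose density belongs to BV(Ω). (The inverse Jacobian of T at (x,y) is the matrix with rows (2√x/a, 0) and (−1/(ab), 1/b).) -/

import Mathlib

open MeasureTheory Set Filter Topology
open scoped ENNReal NNReal Classical

noncomputable section

namespace Liverani

/-- The divergence of a vector field on `ℝ^d`. -/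
def divg {d : ℕ} (φ : (Fin d → ℝ) → (Fin d → ℝ)) (x : Fin d → ℝ) : ℝ :=
  ∑ j, fderiv ℝ φ x (Pi.single j 1) j

/-- Test vector fields: `C¹`, compactly supported, sup-norm `≤ 1`. -/
def IsTest (d : ℕ) (φ : (Fin d → ℝ) → (Fin d → ℝ)) : Prop :=
  ContDiff ℝ 1 φ ∧ HasCompactSupport φ ∧ ∀ x, ‖φ x‖ ≤ 1

/-- The BV seminorm on `ℝ^d`, extended-real valued. -/
def bvNormE {d : ℕ} (h : (Fin d → ℝ) → ℝ) : ℝ≥0∞ :=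
  ⨆ φ : {φ : (Fin d → ℝ) → (Fin d → ℝ) // IsTest d φ},
    ENNReal.ofReal (∫ x, h x * divg φ.1 x)

/-- The BV seminorm, real valued. -/
def bvNorm {d : ℕ} (h : (Fin d → ℝ) → ℝ) : ℝ := (bvNormE h).toReal

/-- Membership in `BV(ℝ^d)`. -/
def MemBV {d : ℕ} (h : (Fin d → ℝ) → ℝ) : Prop :=
  Integrable h volume ∧ bvNormE h < ⊤

/-- The BV seminorm on a set `Ω` (of the extension of `h` by zero), extended-real valued. -/
def bvNormOnE {d : ℕ} (Ω : Set (Fin d → ℝ)) (h : (Fin d → ℝ) → ℝ) : ℝ≥0∞ :=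
  bvNormE (Ω.indicator h)

/-- The BV norm on a set `Ω`. -/
def bvNormOn {d : ℕ} (Ω : Set (Fin d → ℝ)) (h : (Fin d → ℝ) → ℝ) : ℝ :=
  bvNorm (Ω.indicator h)

/-- Membership in `BV(Ω)`: the extension by zero belongs to `BV(ℝ^d)`. -/
def MemBVOn {d : ℕ} (Ω : Set (Fin d → ℝ)) (h : (Fin d → ℝ) → ℝ) : Prop :=
  MemBV (Ω.indicator h)

/-- One-dimensional BV seminorm (for slices). -/
def bvNorm1E (g : ℝ → ℝ) : ℝ≥0∞ :=
  ⨆ φ : {φ : ℝ → ℝ // ContDiff ℝ 1 φ ∧ HasCompactSupport φ ∧ ∀ y, |φ y| ≤ 1},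
    ENNReal.ofReal (∫ y, g y * deriv φ.1 y)

/-- The matrix norm `‖A‖_∞ = max_i Σ_j |A i j|`. -/
def matNorm {d : ℕ} (A : Matrix (Fin d) (Fin d) ℝ) : ℝ :=
  NNReal.toReal (Finset.univ.sup fun i => ∑ j, ‖A i j‖₊)

/-- The Jacobian matrix `DT` of a map `T` computed via `fderiv`. -/
def jac {d : ℕ} (T : (Fin d → ℝ) → (Fin d → ℝ)) (x : Fin d → ℝ) :
    Matrix (Fin d) (Fin d) ℝ :=
  Matrix.of fun i j => fderiv ℝ T x (Pi.single j 1) i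

/-- The inverse Jacobian matrix `(DT)⁻¹`. -/
def jacInv {d : ℕ} (T : (Fin d → ℝ) → (Fin d → ℝ)) (x : Fin d → ℝ) :
    Matrix (Fin d) (Fin d) ℝ :=
  (jac T x)⁻¹

/-- Entrywise partial derivative `∂_{x_j} (DT)⁻¹` of the inverse Jacobian along the
`j`-th coordinate. -/
def jacDj {d : ℕ} (T : (Fin d → ℝ) → (Fin d → ℝ)) (j : Fin d) (z : Fin d → ℝ) :
    Matrix (Fin d) (Fin d) ℝ :=
  Matrix.of fun i i' => deriv (fun y => jacInv T (Function.update z j y) i i') (z j)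

/-- The transfer operator `(L h)(x) = Σ_{y ∈ Ω ∩ T⁻¹{x}} |det D_y T|⁻¹ h(y)`. -/
def transferOp {d : ℕ} (Ω : Set (Fin d → ℝ)) (T : (Fin d → ℝ) → (Fin d → ℝ))
    (h : (Fin d → ℝ) → ℝ) (x : Fin d → ℝ) : ℝ :=
  ∑' y : ↥(Ω ∩ T ⁻¹' {x}), |(jac T y).det|⁻¹ * h y

/-- `Ω_k^ε`, the part of `U` at distance at least `ε` from its boundary. -/
def innerPart {d : ℕ} (U : Set (Fin d → ℝ)) (ε : ℝ) : Set (Fin d → ℝ) :=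
  {x ∈ U | ε ≤ Metric.infDist x (frontier U)}

/-- `∂^ε Ω_k`, the `ε`-boundary layer of `U`. -/
def bLayer {d : ℕ} (U : Set (Fin d → ℝ)) (ε : ℝ) : Set (Fin d → ℝ) :=
  U \ innerPart U ε

/-- `Γ_ε = ∪_k ∂^ε Ω_k`. -/
def Gam {d : ℕ} (parts : ℕ → Set (Fin d → ℝ)) (ε : ℝ) : Set (Fin d → ℝ) :=
  ⋃ k, bLayer (parts k) ε

/-- A piecewise expanding system: the data `Ω, T, {Ω_k}, {I_{k,ℓ}}, δ, λ` together with
hypotheses (H0)–(H5). -/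
structure PES (d : ℕ) where
  Ω : Set (Fin d → ℝ)
  T : (Fin d → ℝ) → (Fin d → ℝ)
  parts : ℕ → Set (Fin d → ℝ)
  Ifam : Fin d → (Fin d → ℝ) → ℕ → ℕ → Set ℝ
  δ : ℝ
  lam : ℝ
  Ω_open : IsOpen Ω
  Ω_subset : Ω ⊆ Set.Icc 0 1
  T_maps : Set.MapsTo T Ω (closure Ω)
  /-- (H0) -/
  h0 : ∀ n : ℕ, volume (T^[n] ⁻¹' frontier Ω) = 0
  /-- (H1) -/
  parts_open : ∀ k, IsOpen (parts k)
  parts_conn : ∀ k, IsPreconnected (parts k)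
  parts_disj : Pairwise (Function.onFun Disjoint parts)
  parts_union : ⋃ k, parts k = Ω
  T_C2 : ∀ k, ContDiffOn ℝ 2 T (parts k)
  T_inv : ∀ k, ∃ S : (Fin d → ℝ) → (Fin d → ℝ),
    ContDiffOn ℝ 1 S (T '' parts k) ∧ ∀ x ∈ parts k, S (T x) = x
  /-- (H2): continuous extension of `T` to the closure of each `Ω_k` -/
  h2T : ∀ k, ∃ g : (Fin d → ℝ) → (Fin d → ℝ),
    ContinuousOn g (closure (parts k)) ∧ Set.EqOn g T (parts k)
  /-- (H2): continuous extension of `(DT)⁻¹` to the closure of each `Ω_k` -/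
  h2D : ∀ k, ∃ G : (Fin d → ℝ) → Matrix (Fin d) (Fin d) ℝ,
    ContinuousOn G (closure (parts k)) ∧ Set.EqOn G (jacInv T) (parts k)
  /-- (H3): the slice structure -/
  δ_pos : 0 < δ
  lam_gt_one : 1 < lam
  Ifam_indep : ∀ (j : Fin d) (x x' : Fin d → ℝ) (k ℓ : ℕ),
    (∀ i, i ≠ j → x i = x' i) → Ifam j x k ℓ = Ifam j x' k ℓ
  Ifam_open : ∀ j x k ℓ, IsOpen (Ifam j x k ℓ)
  Ifam_conn : ∀ j x k ℓ, IsPreconnected (Ifam j x k ℓ)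
  Ifam_disj : ∀ j x k, Pairwise (Function.onFun Disjoint (Ifam j x k))
  Ifam_union : ∀ j x k, {y : ℝ | Function.update x j y ∈ parts k} = ⋃ ℓ, Ifam j x k ℓ
  h3 : ∀ x ∈ Set.Icc (0 : Fin d → ℝ) 1, ∀ j : Fin d,
    (∑' p : ℕ × ℕ,
      if (Set.Icc (x j - δ) (x j + δ) ∩ Ifam j x p.1 p.2).Nonempty then
        ⨆ y ∈ Ifam j x p.1 p.2,
          ENNReal.ofReal (matNorm (jacInv T (Function.update x j y)))
      else 0) ≤ ENNReal.ofReal lam⁻¹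
  /-- (H4) -/
  h4 : ∀ j : Fin d,
    Filter.Tendsto (fun ε : ℝ =>
      ⨆ x : Fin d → ℝ, ∑' k : ℕ, ∫⁻ y in Set.Icc (0:ℝ) 1,
        Set.indicator (bLayer (parts k) ε)
          (fun z => ENNReal.ofReal (matNorm (jacDj T j z)))
          (Function.update x j y))
      (nhdsWithin 0 (Set.Ioi 0)) (nhds 0)
  /-- (H5) -/
  h5 : ∀ i j k : Fin d,
    MeasureTheory.IntegrableOn (fun x => jac T x k j * jacInv T x j i) Ω volume

/-- A piecewise expanding system satisfying in addition hypothesis (H6). -/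
structure PES6 (d : ℕ) extends PES d where
  Cb : ℝ
  αb : ℝ
  ab : ℝ
  Cb_pos : 0 < Cb
  αb_mem : αb ∈ Set.Ioc (0:ℝ) 1
  ab_ge_one : 1 ≤ ab
  /-- (H6): measure of the boundary layers -/
  h6a : ∀ ε : ℝ, 0 < ε →
    volume (⋃ k, bLayer (parts k) ε) ≤ ENNReal.ofReal (Cb ^ d * ε ^ αb)
  /-- (H6): blow-up of `∇ det DT` near the singularities -/
  h6b : ∀ x ∈ Ω, ∀ i : Fin d,
    |fderiv ℝ (fun z => (jac T z).det) x (Pi.single i 1)| ≤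
      Cb * Metric.infDist x (frontier Ω) ^ (-ab)

/-- `μ` is a `T`-invariant probability measure, absolutely continuous w.r.t. Lebesgue,
supported in `Ω`. -/
def InvariantMeasure {d : ℕ} (Ω : Set (Fin d → ℝ)) (T : (Fin d → ℝ) → (Fin d → ℝ))
    (μ : Measure (Fin d → ℝ)) : Prop :=
  IsProbabilityMeasure μ ∧ μ ≪ volume ∧ μ Ωᶜ = 0 ∧
    ∀ A : Set (Fin d → ℝ), MeasurableSet A → μ (T ⁻¹' A) = μ A

/-- `μ` is an ergodic absolutely continuous invariant probability measure. -/
def ErgodicACIM {d : ℕ} (Ω : Set (Fin d → ℝ)) (T : (Fin d → ℝ) → (Fin d → ℝ))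
    (μ : Measure (Fin d → ℝ)) : Prop :=
  InvariantMeasure Ω T μ ∧
    ∀ A : Set (Fin d → ℝ), MeasurableSet A → T ⁻¹' A = A → μ A = 0 ∨ μ A = 1

/-- `h` is a density of `μ` with respect to Lebesgue measure. -/
def IsDensity {d : ℕ} (μ : Measure (Fin d → ℝ)) (h : (Fin d → ℝ) → ℝ) : Prop :=
  ∀ A : Set (Fin d → ℝ), MeasurableSet A → μ A = ∫⁻ x in A, ENNReal.ofReal (h x) ∂volume

/-- The system `(T, μ)` is mixing. -/
def Mixing {d : ℕ} (T : (Fin d → ℝ) → (Fin d → ℝ)) (μ : Measure (Fin d → ℝ)) : Prop :=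
  ∀ A B : Set (Fin d → ℝ), MeasurableSet A → MeasurableSet B →
    Tendsto (fun n : ℕ => μ (T^[n] ⁻¹' A ∩ B)) atTop (𝓝 (μ A * μ B))

/-- A one-dimensional mollifier. -/
def IsMollifier (η : ℝ → ℝ) : Prop :=
  ContDiff ℝ (⊤ : ℕ∞) η ∧ (∀ y, 0 ≤ η y) ∧ Function.support η ⊆ Set.Icc (-1) 1 ∧ ∫ y, η y = 1

/-- The product mollifier `η̄_δ(x) = δ^{-d} Π_i η(δ⁻¹ x_i)`. -/
def moll (d : ℕ) (η : ℝ → ℝ) (δ : ℝ) (x : Fin d → ℝ) : ℝ :=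
  (δ ^ d)⁻¹ * ∏ i, η (δ⁻¹ * x i)

/-- The regularization `h_δ(x) = ∫_Ω η̄_δ(x-y) h(y) dy + δ`. -/
def mollify (d : ℕ) (η : ℝ → ℝ) (Ω : Set (Fin d → ℝ)) (h : (Fin d → ℝ) → ℝ)
    (δ : ℝ) (x : Fin d → ℝ) : ℝ :=
  (∫ y in Ω, moll d η δ (x - y) * h y) + δ

/-- `ν₀ = ‖(DT)⁻¹‖_{L∞(Ω)}`. -/
def nu0 {d : ℕ} (Ω : Set (Fin d → ℝ)) (T : (Fin d → ℝ) → (Fin d → ℝ)) : ℝ :=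
  (essSup (fun x => ENNReal.ofReal (matNorm (jacInv T x))) (volume.restrict Ω)).toReal

/-- The truncated ("open") transfer operators
`L̃_{ε,n} = L_{ε,0} ⋯ L_{ε,n-1}` where `L_{ε,k} f = L((1 - 1_{Γ_{ε ν^k}}) f)`. -/
def tildeOp {d : ℕ} (Ω : Set (Fin d → ℝ)) (T : (Fin d → ℝ) → (Fin d → ℝ))
    (parts : ℕ → Set (Fin d → ℝ)) (ν : ℝ) :
    ℕ → ℝ → ((Fin d → ℝ) → ℝ) → (Fin d → ℝ) → ℝ
  | 0, _, f => f
  | n + 1, ε, f => transferOp Ω T (((Gam parts ε)ᶜ).indicator (tildeOp Ω T parts ν n (ε * ν) f))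


/-- The domain of the example map. -/
def exOmega (a b : ℝ) : Set (Fin 2 → ℝ) :=
  {p | p 0 ∈ Set.Ioo (0:ℝ) 1 ∧ p 1 ∈ Set.Ioo (0:ℝ) 1 ∧
    (¬ ∃ k : ℤ, a * Real.sqrt (p 0) = (k : ℝ)) ∧
    (¬ ∃ k : ℤ, b * p 1 + Real.sqrt (p 0) = (k : ℝ))}

/-- The example map `T(x,y) = (a√x, by + √x) mod 1`. -/
def exT (a b : ℝ) : (Fin 2 → ℝ) → (Fin 2 → ℝ) := fun p =>
  ![Int.fract (a * Real.sqrt (p 0)), Int.fract (b * p 1 + Real.sqrt (p 0))]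

/-! ### Expanding maps of the interval: bounds on observables with bounded primitive -/

/-- `τ` contracts, up to an additive constant, the primitives of bounded observables with zero
mean on `[0, 1]`: this is the Lasota–Yorke inequality, written on the dual side. -/
def ContractsPrimitives (ρ : ℝ) (τ : ℝ → ℝ) : Prop :=
  Measurable τ ∧ ∀ (w : ℝ → ℝ) (A : ℝ), Measurable w → (∃ K, ∀ t, |w t| ≤ K) →
    (∫ s in (0:ℝ)..1, w s) = 0 → (∀ t ∈ Icc (0:ℝ) 1, |∫ s in (0:ℝ)..t, w s| ≤ A) →
    |∫ s in (0:ℝ)..1, w (τ s)| ≤ ρ * A ∧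
    ∀ t ∈ Icc (0:ℝ) 1, |(∫ s in (0:ℝ)..t, w (τ s)) - t * ∫ s in (0:ℝ)..1, w (τ s)| ≤ ρ * A

/-- The composition `τ (n-1) ∘ ⋯ ∘ τ 0`. -/
def seqComp (τ : ℕ → ℝ → ℝ) : ℕ → ℝ → ℝ
  | 0, y => y
  | n + 1, y => τ n (seqComp τ n y)

lemma intervalIntegrable_of_bounded {w : ℝ → ℝ} (hw : Measurable w) {K : ℝ}
    (hK : ∀ t, |w t| ≤ K) (p q : ℝ) : IntervalIntegrable w volume p q := by
  refine (intervalIntegrable_const (c := K)).mono_fun hw.aestronglyMeasurable ?_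
  exact Eventually.of_forall fun t => by
    simpa using (hK t).trans (le_abs_self K)

lemma measurable_seqComp {τ : ℕ → ℝ → ℝ} (hτ : ∀ i, Measurable (τ i)) :
    ∀ n, Measurable (seqComp τ n)
  | 0 => measurable_id
  | n + 1 => (hτ n).comp (measurable_seqComp hτ n)

lemma abs_integral_seqComp_le {ρ : ℝ} (hρ : ρ < 1) {τ : ℕ → ℝ → ℝ}
    (hτ : ∀ i, ContractsPrimitives ρ (τ i)) (n : ℕ) (w : ℝ → ℝ) (A : ℝ) (hw : Measurable w)
    (hK : ∃ K, ∀ t, |w t| ≤ K) (h0 : (∫ s in (0:ℝ)..1, w s) = 0)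
    (hA : ∀ t ∈ Icc (0:ℝ) 1, |∫ s in (0:ℝ)..t, w s| ≤ A) :
    |∫ s in (0:ℝ)..1, w (seqComp τ n s)| ≤ |ρ| / (1 - ρ) * A := by
  have hA0 : 0 ≤ A := (abs_nonneg _).trans (hA 0 (by simp))
  induction n generalizing w A with
  | zero =>
    have : 0 ≤ |ρ| / (1 - ρ) * A :=
      mul_nonneg (div_nonneg (abs_nonneg _) (by linarith)) hA0
    simpa [seqComp, h0] using this
  | succ n ih =>
    obtain ⟨K, hK⟩ := hK
    obtain ⟨h1, h2⟩ := (hτ n).2 w A hw ⟨K, hK⟩ h0 hA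
    set c := ∫ s in (0:ℝ)..1, w (τ n s) with hc
    have hwτ : Measurable fun s => w (τ n s) := hw.comp (hτ n).1
    have h_int : ∀ p q, IntervalIntegrable (fun s => w (τ n s)) volume p q :=
      intervalIntegrable_of_bounded hwτ fun t => hK _
    have hsub : ∀ t, (∫ s in (0:ℝ)..t, (w (τ n s) - c)) = (∫ s in (0:ℝ)..t, w (τ n s)) - t * c := by
      intro t
      rw [intervalIntegral.integral_sub (h_int _ _) (by simp)]
      simp
    have hρA : 0 ≤ ρ * A := (abs_nonneg _).trans h1
    have key := ih (fun s => w (τ n s) - c) (ρ * A) (hwτ.sub_const c)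
      ⟨K + |c|, fun t => (abs_sub _ _).trans (by gcongr; exact hK _)⟩
      (by rw [hsub, ← hc]; ring) (fun t ht => by rw [hsub]; exact h2 t ht) hρA
    have hm : Measurable (seqComp τ n) := measurable_seqComp (fun i => (hτ i).1) n
    have e : (∫ s in (0:ℝ)..1, w (seqComp τ (n + 1) s))
        = (∫ s in (0:ℝ)..1, (w (τ n (seqComp τ n s)) - c)) + c := by
      have hcomp : IntervalIntegrable (fun s => w (τ n (seqComp τ n s))) volume 0 1 :=
        intervalIntegrable_of_bounded (hwτ.comp hm) (fun t => hK _) _ _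
      rw [intervalIntegral.integral_sub hcomp (by simp)]
      simp [seqComp]
    rw [e]
    refine (abs_add_le _ _).trans ((add_le_add key h1).trans ?_)
    have h3 : ρ * A ≤ |ρ| * A := by gcongr; exact le_abs_self ρ
    have h4 : (0:ℝ) < 1 - ρ := by linarith
    calc |ρ| / (1 - ρ) * (ρ * A) + ρ * A ≤ |ρ| / (1 - ρ) * (ρ * A) + |ρ| * A := by gcongr
      _ = |ρ| / (1 - ρ) * A := by field_simp; ring

/-- Along a sequence of such maps Lebesgue measure keeps a uniformly bounded density. -/
lemma integral_seqComp_le {ρ : ℝ} (hρ : ρ < 1) {τ : ℕ → ℝ → ℝ}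
    (hτ : ∀ i, ContractsPrimitives ρ (τ i)) (n : ℕ) (w : ℝ → ℝ) (hw : Measurable w)
    (hpos : ∀ t, 0 ≤ w t) (hK : ∃ K, ∀ t, w t ≤ K) :
    (∫ s in (0:ℝ)..1, w (seqComp τ n s)) ≤
      (1 + |ρ| / (1 - ρ)) * ∫ s in (0:ℝ)..1, w s := by
  obtain ⟨K, hK⟩ := hK
  have hKa : ∀ t, |w t| ≤ K := fun t => by rw [abs_of_nonneg (hpos t)]; exact hK t
  have h_int := intervalIntegrable_of_bounded hw hKa
  set I := ∫ s in (0:ℝ)..1, w s with hI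
  have hI0 : 0 ≤ I := intervalIntegral.integral_nonneg zero_le_one fun t _ => hpos t
  have hsub : ∀ t, (∫ s in (0:ℝ)..t, (w s - I)) = (∫ s in (0:ℝ)..t, w s) - t * I := by
    intro t
    rw [intervalIntegral.integral_sub (h_int _ _) (by simp)]
    simp
  have key := abs_integral_seqComp_le hρ hτ n (fun s => w s - I) I (hw.sub_const I)
    ⟨K + |I|, fun t => (abs_sub _ _).trans (by gcongr; exact hKa _)⟩
    (by rw [hsub, ← hI]; ring) (fun t ht => by
      rw [hsub]
      have h1 : 0 ≤ ∫ s in (0:ℝ)..t, w s :=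
        intervalIntegral.integral_nonneg ht.1 fun t _ => hpos t
      have h2 : (∫ s in (0:ℝ)..t, w s) ≤ I :=
        intervalIntegral.integral_mono_interval le_rfl ht.1 ht.2
          (Eventually.of_forall hpos) (h_int _ _)
      have h3 : 0 ≤ t * I := mul_nonneg ht.1 hI0
      have h4 : t * I ≤ I := mul_le_of_le_one_left hI0 ht.2
      rw [abs_le]; constructor <;> linarith)
  have hm : Measurable (seqComp τ n) := measurable_seqComp (fun i => (hτ i).1) n
  have hcomp : IntervalIntegrable (fun s => w (seqComp τ n s)) volume 0 1 :=
    intervalIntegrable_of_bounded (hw.comp hm) (fun t => hKa _) _ _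
  rw [intervalIntegral.integral_sub hcomp (by simp)] at key
  have := (le_abs_self _).trans key
  simp only [intervalIntegral.integral_const, sub_zero, one_smul] at this
  linarith

section Periodic

variable {w : ℝ → ℝ} {A K : ℝ}

lemma abs_integral_fract_le (hw : Measurable w) (hK : ∀ t, |w t| ≤ K)
    (h0 : (∫ s in (0:ℝ)..1, w s) = 0) (hA : ∀ t ∈ Icc (0:ℝ) 1, |∫ s in (0:ℝ)..t, w s| ≤ A)
    (z : ℝ) : |∫ s in (0:ℝ)..z, w (Int.fract s)| ≤ A := by
  have hper : Function.Periodic (fun s => w (Int.fract s)) 1 := fun s => by simp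
  have h_int : ∀ p q, IntervalIntegrable (fun s => w (Int.fract s)) volume p q :=
    intervalIntegrable_of_bounded (hw.comp measurable_fract) fun t => hK _
  have hcongr : ∀ t ∈ Icc (0:ℝ) 1, (∫ s in (0:ℝ)..t, w (Int.fract s)) = ∫ s in (0:ℝ)..t, w s := by
    intro t ht
    refine intervalIntegral.integral_congr_ae ?_
    filter_upwards [compl_mem_ae_iff.2 (measure_singleton (1:ℝ))] with s hs hs'
    rw [uIoc_of_le ht.1] at hs'
    rw [Int.fract_eq_self.2 ⟨hs'.1.le, lt_of_le_of_ne (hs'.2.trans ht.2) hs⟩]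
  have h1 : (∫ s in (Int.fract z)..(Int.fract z + ⌊z⌋ • (1:ℝ)), w (Int.fract s)) = 0 := by
    rw [hper.intervalIntegral_add_zsmul_eq _ _ h_int, hper.intervalIntegral_add_eq _ 0, zero_add,
      hcongr 1 (by simp), h0, smul_zero]
  have h2 : Int.fract z + ⌊z⌋ • (1:ℝ) = z := by simp
  rw [h2] at h1
  have hz : Int.fract z ∈ Icc (0:ℝ) 1 := ⟨Int.fract_nonneg z, (Int.fract_lt_one z).le⟩
  rw [← intervalIntegral.integral_add_adjacent_intervals (h_int 0 (Int.fract z)) (h_int _ z), h1,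
    add_zero, hcongr _ hz]
  exact hA _ hz

lemma abs_integral_fract_sqrt_le {a : ℝ} (ha : 0 < a) (hw : Measurable w) (hK : ∀ t, |w t| ≤ K)
    (h0 : (∫ s in (0:ℝ)..1, w s) = 0) (hA : ∀ t ∈ Icc (0:ℝ) 1, |∫ s in (0:ℝ)..t, w s| ≤ A)
    (z : ℝ) : |∫ r in (0:ℝ)..z, w (Int.fract (a * r))| ≤ A / a := by
  have := abs_integral_fract_le hw hK h0 hA (a * z)
  rw [intervalIntegral.integral_comp_mul_left (fun s => w (Int.fract s)) ha.ne', mul_zero, smul_eq_mul, abs_mul,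
    abs_of_pos (inv_pos.2 ha), div_eq_inv_mul]
  gcongr

end Periodic

lemma contractsPrimitives_affine {b : ℝ} (hb : 0 < b) (c : ℝ) :
    ContractsPrimitives (2 / b) fun y => Int.fract (b * y + c) := by
  refine ⟨measurable_fract.comp (by fun_prop), ?_⟩
  rintro w A hw ⟨K, hK⟩ h0 hA
  have hP := abs_integral_fract_le hw hK h0 hA
  have h_int : ∀ p q, IntervalIntegrable (fun s => w (Int.fract s)) volume p q :=
    intervalIntegrable_of_bounded (hw.comp measurable_fract) fun t => hK _
  set P : ℝ → ℝ := fun z => ∫ s in (0:ℝ)..z, w (Int.fract s) with hPdef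
  have hX : ∀ t, (∫ s in (0:ℝ)..t, w (Int.fract (b * s + c))) = (P (b * t + c) - P c) / b := by
    intro t
    rw [intervalIntegral.integral_comp_mul_add (fun s => w (Int.fract s)) hb.ne', mul_zero,
      zero_add, ← intervalIntegral.integral_interval_sub_left (h_int 0 _) (h_int 0 _), smul_eq_mul]
    simp only [hPdef]
    field_simp
  have hc := abs_le.1 (hP c)
  have h1 := abs_le.1 (hP (b * 1 + c))
  simp only [hX]
  rw [show 2 / b * A = 2 * A / b by ring]
  constructor
  · rw [abs_div, abs_of_pos hb]
    gcongr
    exact abs_le.2 (by constructor <;> linarith)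
  · intro t ht
    have ht' := abs_le.1 (hP (b * t + c))
    rw [show (P (b * t + c) - P c) / b - t * ((P (b * 1 + c) - P c) / b)
      = (P (b * t + c) - (1 - t) * P c - t * P (b * 1 + c)) / b by ring, abs_div, abs_of_pos hb]
    gcongr
    have := ht.1
    have := ht.2
    exact abs_le.2 (by constructor <;> nlinarith)

lemma integral_fract_sqrt {a : ℝ} {w : ℝ → ℝ} {K : ℝ} (hw : Measurable w)
    (hK : ∀ t, |w t| ≤ K) {t : ℝ} (ht : 0 ≤ t) :
    (∫ s in (0:ℝ)..t, w (Int.fract (a * √s))) =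
      2 * √t * (∫ r in (0:ℝ)..√t, w (Int.fract (a * r))) -
        2 * ∫ z in (0:ℝ)..√t, ∫ r in (0:ℝ)..z, w (Int.fract (a * r)) := by
  set v : ℝ → ℝ := fun r => w (Int.fract (a * r)) with hv
  have hvm : Measurable v := hw.comp (measurable_fract.comp (by fun_prop))
  have h_int : ∀ p q, IntervalIntegrable v volume p q :=
    intervalIntegrable_of_bounded hvm fun t => hK _
  have hst : 0 ≤ √t := Real.sqrt_nonneg t
  have himg : (fun r : ℝ => r ^ 2) '' Ioc 0 (√t) = Ioc 0 t := by
    ext s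
    constructor
    · rintro ⟨r, hr, rfl⟩
      refine ⟨by have := hr.1; positivity, ?_⟩
      have := pow_le_pow_left₀ hr.1.le hr.2 2
      simpa [Real.sq_sqrt ht] using this
    · intro hs
      exact ⟨√s, ⟨Real.sqrt_pos.2 hs.1, Real.sqrt_le_sqrt hs.2⟩, Real.sq_sqrt hs.1.le⟩
  have hcv : (∫ s in (0:ℝ)..t, v (√s)) = ∫ r in (0:ℝ)..√t, (2 * r) * v r := by
    rw [intervalIntegral.integral_of_le ht, intervalIntegral.integral_of_le hst, ← himg,
      integral_image_eq_integral_abs_deriv_smul (f' := fun r => 2 * r) measurableSet_Ioc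
        (fun r _ => by simpa using (hasDerivAt_pow 2 r).hasDerivWithinAt)
        (fun r hr s hs h => by
          have h1 := hr.1
          have h2 := hs.1
          exact (pow_left_inj₀ h1.le h2.le two_ne_zero).1 h)]
    refine setIntegral_congr_fun measurableSet_Ioc fun r hr => ?_
    have h1 : 0 < r := hr.1
    simp [abs_of_pos h1, Real.sqrt_sq h1.le]
  have hP : AbsolutelyContinuousOnInterval (fun z => ∫ r in (0:ℝ)..z, v r) 0 (√t) :=
    (h_int 0 _).absolutelyContinuousOnInterval_intervalIntegral (c := 0) (by simp)
  have hid : AbsolutelyContinuousOnInterval (fun r : ℝ => 2 * r) 0 (√t) :=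
    ContDiffOn.absolutelyContinuousOnInterval (by fun_prop)
  have hparts := hid.integral_mul_deriv_eq_deriv_mul hP
  have hd : (∫ r in (0:ℝ)..√t, (2 * r) * v r)
      = ∫ r in (0:ℝ)..√t, (2 * r) * deriv (fun z => ∫ r in (0:ℝ)..z, v r) r := by
    refine intervalIntegral.integral_congr_ae ?_
    filter_upwards [(h_int 0 (√t)).ae_hasDerivAt_integral] with r hr hr'
    rw [(hr (uIoc_subset_uIcc hr') 0 (by simp)).deriv]
  change (∫ s in (0:ℝ)..t, v (√s)) = _
  rw [hcv, hd, hparts]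
  have : ∀ x : ℝ, deriv (fun r : ℝ => 2 * r) x = 2 := fun x => by
    simp
  simp only [this, intervalIntegral.integral_const_mul]
  ring

lemma contractsPrimitives_sqrt {a : ℝ} (ha : 0 < a) :
    ContractsPrimitives (4 / a) fun x => Int.fract (a * √x) := by
  refine ⟨measurable_fract.comp (by fun_prop), ?_⟩
  rintro w A hw ⟨K, hK⟩ h0 hA
  have hP := abs_integral_fract_sqrt_le ha hw hK h0 hA
  have hX := fun t (ht : 0 ≤ t) => integral_fract_sqrt (a := a) hw hK ht
  have hvint : ∀ p q, IntervalIntegrable (fun r => w (Int.fract (a * r))) volume p q :=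
    intervalIntegrable_of_bounded (hw.comp (measurable_fract.comp (by fun_prop))) fun t => hK _
  have hPint : ∀ p q, IntervalIntegrable (fun z => ∫ r in (0:ℝ)..z, w (Int.fract (a * r)))
      volume p q := fun p q =>
    (intervalIntegral.continuous_primitive hvint 0).intervalIntegrable p q
  set P : ℝ → ℝ := fun z => ∫ r in (0:ℝ)..z, w (Int.fract (a * r)) with hPdef
  have hE : ∀ p q : ℝ, p ≤ q → |∫ z in p..q, P z| ≤ A / a * (q - p) := by
    intro p q hpq
    have := intervalIntegral.norm_integral_le_of_norm_le_const (a := p) (b := q) (f := P)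
      (C := A / a) fun z _ => hP z
    rwa [abs_of_nonneg (by linarith), Real.norm_eq_abs] at this
  have hP1 := abs_le.1 (hP 1)
  have hE1 := abs_le.1 (hE 0 1 zero_le_one)
  set B := A / a with hB
  have hB0 : 0 ≤ B := (abs_nonneg _).trans (hP 0)
  rw [show 4 / a * A = 4 * B by rw [hB]; ring]
  have hX1 := hX 1 zero_le_one
  rw [Real.sqrt_one] at hX1
  rw [hX1]
  constructor
  · rw [abs_le]; constructor <;> linarith
  · intro t ht
    rw [hX t ht.1]
    set s := √t with hs
    have hs0 : 0 ≤ s := Real.sqrt_nonneg t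
    have hs1 : s ≤ 1 := Real.sqrt_le_one.2 ht.2
    have hts : t = s ^ 2 := (Real.sq_sqrt ht.1).symm
    have hsplit : (∫ z in (0:ℝ)..1, P z) = (∫ z in (0:ℝ)..s, P z) + ∫ z in s..1, P z :=
      (intervalIntegral.integral_add_adjacent_intervals (hPint _ _) (hPint _ _)).symm
    have hEs := hE 0 s hs0
    have hEs' := hE s 1 hs1
    have hPs := hP s
    change |2 * s * P s - 2 * (∫ z in (0:ℝ)..s, P z)
      - t * (2 * 1 * P 1 - 2 * ∫ z in (0:ℝ)..1, P z)| ≤ 4 * B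
    rw [hsplit, hts]
    set e := ∫ z in (0:ℝ)..s, P z
    set e' := ∫ z in s..1, P z
    have hP1' : |P 1| ≤ B := hP 1
    calc |2 * s * P s - 2 * e - s ^ 2 * (2 * 1 * P 1 - 2 * (e + e'))|
        = |(2 * s) * P s + (-(2 * s ^ 2)) * P 1 + (-(2 * (1 - s ^ 2))) * e + (2 * s ^ 2) * e'| := by
          ring_nf
      _ ≤ |(2 * s) * P s| + |(-(2 * s ^ 2)) * P 1| + |(-(2 * (1 - s ^ 2))) * e|
          + |(2 * s ^ 2) * e'| := by
          refine (abs_add_le _ _).trans (add_le_add_left ?_ _)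
          exact (abs_add_le _ _).trans (add_le_add_left (abs_add_le _ _) _)
      _ = (2 * s) * |P s| + (2 * s ^ 2) * |P 1| + (2 * (1 - s ^ 2)) * |e| + (2 * s ^ 2) * |e'| := by
          have h2 : 0 ≤ 1 - s ^ 2 := by nlinarith
          simp only [abs_mul, abs_neg, abs_of_nonneg hs0, abs_of_nonneg h2, abs_two,
            abs_of_nonneg (sq_nonneg s)]
      _ ≤ (2 * s) * B + (2 * s ^ 2) * B + (2 * (1 - s ^ 2)) * (B * (s - 0))
          + (2 * s ^ 2) * (B * (1 - s)) := by
          have h2 : 0 ≤ 1 - s ^ 2 := by nlinarith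
          gcongr
      _ = B * (4 - 4 * ((1 - s) ^ 2 * (1 + s))) := by ring
      _ ≤ B * 4 := by
          have : 0 ≤ (1 - s) ^ 2 * (1 + s) := by positivity
          exact mul_le_mul_of_nonneg_left (by linarith) hB0
      _ = 4 * B := by ring

/-! ### The skew product on the plane -/

/-- Lebesgue measure on the open unit interval. -/
def unitI : Measure ℝ := volume.restrict (Ioo 0 1)

/-- Lebesgue measure on the open unit square. -/
def unitSq : Measure (ℝ × ℝ) := unitI.prod unitI

/-- The example map, on `ℝ × ℝ`. -/
def skew (a b : ℝ) (p : ℝ × ℝ) : ℝ × ℝ :=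
  (Int.fract (a * √p.1), Int.fract (b * p.2 + √p.1))

/-- The iterates of the first coordinate of the example map. -/
def baseIter (a : ℝ) : ℕ → ℝ → ℝ := seqComp fun _ x => Int.fract (a * √x)

/-- The iterates of the second coordinate of the example map over the base point `x`. -/
def fibIter (a b x : ℝ) : ℕ → ℝ → ℝ :=
  seqComp fun i y => Int.fract (b * y + √(baseIter a i x))

instance : IsProbabilityMeasure unitI := ⟨by simp [unitI]⟩

instance : IsProbabilityMeasure unitSq := by unfold unitSq; infer_instance

lemma unitSq_eq_restrict : unitSq = volume.restrict (Ioo (0:ℝ) 1 ×ˢ Ioo (0:ℝ) 1) := by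
  rw [unitSq, unitI, Measure.prod_restrict, ← Measure.volume_eq_prod]

lemma ae_unitSq_mem : ∀ᵐ p ∂unitSq, p ∈ Ioo (0:ℝ) 1 ×ˢ Ioo (0:ℝ) 1 := by
  rw [unitSq_eq_restrict]
  exact ae_restrict_mem (measurableSet_Ioo.prod measurableSet_Ioo)

lemma integral_unitI (f : ℝ → ℝ) : ∫ x, f x ∂unitI = ∫ x in (0:ℝ)..1, f x := by
  rw [intervalIntegral.integral_of_le zero_le_one, unitI, integral_Ioc_eq_integral_Ioo]

lemma measurable_skew (a b : ℝ) : Measurable (skew a b) := by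
  unfold skew
  exact (measurable_fract.comp (by fun_prop)).prodMk (measurable_fract.comp (by fun_prop))

lemma skew_iterate (a b : ℝ) (n : ℕ) (p : ℝ × ℝ) :
    (skew a b)^[n] p = (baseIter a n p.1, fibIter a b p.1 n p.2) := by
  induction n with
  | zero => rfl
  | succ n ih => rw [Function.iterate_succ_apply', ih]; rfl

lemma integrable_of_abs_le {α : Type*} [MeasurableSpace α] {μ : Measure α} [IsFiniteMeasure μ]
    {f : α → ℝ} (hf : Measurable f) {K : ℝ} (hK : ∀ x, |f x| ≤ K) : Integrable f μ :=
  Integrable.of_bound hf.aestronglyMeasurable K (Eventually.of_forall hK)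

lemma measurable_section_integral {g : ℝ × ℝ → ℝ} (hg : Measurable g) :
    Measurable fun x => ∫ y in (0:ℝ)..1, g (x, y) := by
  simp_rw [← integral_unitI]
  exact hg.stronglyMeasurable.integral_prod_right'.measurable

lemma abs_section_integral_le {f : ℝ → ℝ} {K : ℝ} (hK : ∀ x, |f x| ≤ K) :
    |∫ y in (0:ℝ)..1, f y| ≤ K := by
  simpa using intervalIntegral.norm_integral_le_of_norm_le_const (a := (0:ℝ)) (b := 1) (f := f)
    (C := K) fun z _ => hK z

lemma integral_unitSq {g : ℝ × ℝ → ℝ} (hg : Measurable g) {K : ℝ} (hK : ∀ p, |g p| ≤ K) :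
    ∫ p, g p ∂unitSq = ∫ x in (0:ℝ)..1, ∫ y in (0:ℝ)..1, g (x, y) := by
  rw [unitSq, integral_prod _ (integrable_of_abs_le hg hK), integral_unitI]
  simp_rw [integral_unitI]

lemma integral_skew_iterate (a b : ℝ) (n : ℕ) {g : ℝ × ℝ → ℝ} (hg : Measurable g) {K : ℝ}
    (hK : ∀ p, |g p| ≤ K) :
    ∫ p, g ((skew a b)^[n] p) ∂unitSq =
      ∫ x in (0:ℝ)..1, ∫ y in (0:ℝ)..1, g (baseIter a n x, fibIter a b x n y) := by
  rw [integral_unitSq (g := fun p => g ((skew a b)^[n] p))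
    (hg.comp ((measurable_skew a b).iterate n)) fun p => hK _]
  simp_rw [skew_iterate]

section Skew

variable {a b : ℝ}

lemma measurable_baseIter (a : ℝ) (n : ℕ) : Measurable (baseIter a n) :=
  measurable_seqComp (fun _ => measurable_fract.comp (by fun_prop)) n

lemma integral_skew_iterate_le (ha : 4 < a) (hb : 2 < b) (n : ℕ) {g : ℝ × ℝ → ℝ}
    (hg : Measurable g) (hpos : ∀ p, 0 ≤ g p) {K : ℝ} (hK : ∀ p, g p ≤ K) :
    ∫ p, g ((skew a b)^[n] p) ∂unitSq ≤
      (1 + |2 / b| / (1 - 2 / b)) * (1 + |4 / a| / (1 - 4 / a)) * ∫ p, g p ∂unitSq := by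
  have hKa : ∀ p, |g p| ≤ K := fun p => by rw [abs_of_nonneg (hpos p)]; exact hK p
  have hρa : 4 / a < 1 := by rw [div_lt_one] <;> linarith
  have hρb : 2 / b < 1 := by rw [div_lt_one] <;> linarith
  rw [integral_skew_iterate a b n hg hKa, integral_unitSq hg hKa]
  have hcb : 0 ≤ 1 + |2 / b| / (1 - 2 / b) := by
    have := div_nonneg (abs_nonneg (2 / b)) (sub_pos.2 hρb).le
    linarith
  set N : ℝ → ℝ := fun u => ∫ v in (0:ℝ)..1, g (u, v) with hN
  have hNm : Measurable N := measurable_section_integral hg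
  have hNb : ∀ u, |N u| ≤ K := fun u => abs_section_integral_le fun v => hKa _
  have hN0 : ∀ u, 0 ≤ N u := fun u =>
    intervalIntegral.integral_nonneg zero_le_one fun t _ => hpos _
  have hfib : ∀ x, (∫ y in (0:ℝ)..1, g (baseIter a n x, fibIter a b x n y)) ≤
      (1 + |2 / b| / (1 - 2 / b)) * N (baseIter a n x) := fun x =>
    integral_seqComp_le hρb (fun i => contractsPrimitives_affine (by linarith) _) n
      (fun v => g (baseIter a n x, v)) (hg.comp (by fun_prop)) (fun t => hpos _) ⟨K, fun t => hK _⟩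
  have hbase := integral_seqComp_le hρa (τ := fun _ x => Int.fract (a * √x))
    (fun i => contractsPrimitives_sqrt (by linarith)) n N hNm hN0
    ⟨K, fun u => (le_abs_self _).trans (hNb u)⟩
  have hin : Measurable fun x => ∫ y in (0:ℝ)..1, g (baseIter a n x, fibIter a b x n y) := by
    have := measurable_section_integral (hg.comp ((measurable_skew a b).iterate n))
    simpa only [Function.comp_def, skew_iterate] using this
  calc (∫ x in (0:ℝ)..1, ∫ y in (0:ℝ)..1, g (baseIter a n x, fibIter a b x n y))
      ≤ ∫ x in (0:ℝ)..1, (1 + |2 / b| / (1 - 2 / b)) * N (baseIter a n x) := by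
        refine intervalIntegral.integral_mono_on zero_le_one
          (intervalIntegrable_of_bounded hin (K := K)
            (fun t => abs_section_integral_le fun y => hKa _) _ _)
          ((intervalIntegrable_of_bounded (hNm.comp (measurable_baseIter a n))
            (fun t => hNb _) _ _).const_mul _) fun x _ => hfib x
    _ = (1 + |2 / b| / (1 - 2 / b)) * ∫ x in (0:ℝ)..1, N (baseIter a n x) := by simp
    _ ≤ _ := by
        rw [mul_assoc]
        exact mul_le_mul_of_nonneg_left hbase hcb

/-- The images of Lebesgue measure have uniformly bounded densities. -/
lemma exists_map_skew_iterate_le (ha : 4 < a) (hb : 2 < b) :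
    ∃ K : ℝ≥0∞, K ≠ ⊤ ∧ ∀ n, unitSq.map (skew a b)^[n] ≤ K • unitSq := by
  set c := (1 + |2 / b| / (1 - 2 / b)) * (1 + |4 / a| / (1 - 4 / a)) with hc
  have hc0 : 0 ≤ c := by
    have hρa : 4 / a < 1 := by rw [div_lt_one] <;> linarith
    have hρb : 2 / b < 1 := by rw [div_lt_one] <;> linarith
    have h1 := div_nonneg (abs_nonneg (2 / b)) (sub_pos.2 hρb).le
    have h2 := div_nonneg (abs_nonneg (4 / a)) (sub_pos.2 hρa).le
    positivity
  refine ⟨ENNReal.ofReal c, ENNReal.ofReal_ne_top, fun n => Measure.le_iff.2 fun B hB => ?_⟩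
  have hT := (measurable_skew a b).iterate n
  have key := integral_skew_iterate_le ha hb n (g := B.indicator 1)
    (measurable_one.indicator hB) (fun p => indicator_nonneg (fun _ _ => zero_le_one) p)
    (K := 1) (fun p => indicator_le_self' (fun _ _ => zero_le_one) p)
  rw [← hc, integral_indicator_one hB] at key
  have h1 : (fun p => B.indicator (1 : ℝ × ℝ → ℝ) ((skew a b)^[n] p))
      = ((skew a b)^[n] ⁻¹' B).indicator 1 := by
    ext p; simp [indicator]
  rw [h1, integral_indicator_one (hT hB)] at key
  rw [Measure.map_apply hT hB, Measure.smul_apply, smul_eq_mul,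
    ← ENNReal.toReal_le_toReal (measure_ne_top _ _)
      (ENNReal.mul_ne_top ENNReal.ofReal_ne_top (measure_ne_top _ _)),
    ENNReal.toReal_mul, ENNReal.toReal_ofReal hc0]
  exact key

lemma continuous_fderiv_apply_const {φ : ℝ × ℝ → ℝ} (hφ : ContDiff ℝ 1 φ) (v : ℝ × ℝ) :
    Continuous fun p => fderiv ℝ φ p v :=
  (hφ.continuous_fderiv one_ne_zero).clm_apply continuous_const

lemma exists_abs_fderiv_apply_le {φ : ℝ × ℝ → ℝ} (hφ : ContDiff ℝ 1 φ)
    (hs : HasCompactSupport φ) (v : ℝ × ℝ) : ∃ K, ∀ p, |fderiv ℝ φ p v| ≤ K :=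
  (hs.fderiv_apply (𝕜 := ℝ) v).exists_bound_of_continuous (continuous_fderiv_apply_const hφ v)

lemma hasDerivAt_snd {φ : ℝ × ℝ → ℝ} (hφ : ContDiff ℝ 1 φ) (u v : ℝ) :
    HasDerivAt (fun s => φ (u, s)) (fderiv ℝ φ (u, v) (0, 1)) v :=
  ((hφ.differentiable one_ne_zero).differentiableAt.hasFDerivAt (x := (u, v))).comp_hasDerivAt v
    ((hasDerivAt_const v u).prodMk (hasDerivAt_id v))

lemma hasDerivAt_fst {φ : ℝ × ℝ → ℝ} (hφ : ContDiff ℝ 1 φ) (u v : ℝ) :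
    HasDerivAt (fun s => φ (s, v)) (fderiv ℝ φ (u, v) (1, 0)) u :=
  ((hφ.differentiable one_ne_zero).differentiableAt.hasFDerivAt (x := (u, v))).comp_hasDerivAt u
    ((hasDerivAt_id u).prodMk (hasDerivAt_const u v))

/-- The images of Lebesgue measure have uniformly bounded variation in the second coordinate. -/
lemma abs_integral_fderiv_snd_le (hb : 2 < b) (n : ℕ) {φ : ℝ × ℝ → ℝ} (hφ : ContDiff ℝ 1 φ)
    (hs : HasCompactSupport φ) {A : ℝ} (hA : ∀ p, |φ p| ≤ A) :
    |∫ p, fderiv ℝ φ ((skew a b)^[n] p) (0, 1) ∂unitSq| ≤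
      (2 + 4 * (|2 / b| / (1 - 2 / b))) * A := by
  have hρb : 2 / b < 1 := by rw [div_lt_one] <;> linarith
  obtain ⟨K, hK⟩ := exists_abs_fderiv_apply_le hφ hs (0, 1)
  have hcont := continuous_fderiv_apply_const hφ (0, 1)
  rw [integral_skew_iterate a b n (g := fun q => fderiv ℝ φ q (0, 1)) hcont.measurable hK]
  refine abs_section_integral_le fun x => ?_
  set u := baseIter a n x
  set w : ℝ → ℝ := fun v => fderiv ℝ φ (u, v) (0, 1) with hw
  have hwc : Continuous w := hcont.comp (by fun_prop)
  have hwK : ∀ v, |w v| ≤ K := fun v => hK _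
  set d := φ (u, 1) - φ (u, 0) with hd
  have h_int : ∀ t, (∫ s in (0:ℝ)..t, w s) = φ (u, t) - φ (u, 0) := fun t =>
    intervalIntegral.integral_eq_sub_of_hasDerivAt (f := fun s => φ (u, s))
      (fun s _ => hasDerivAt_snd hφ u s) (hwc.intervalIntegrable _ _)
  have hsub : ∀ t, (∫ s in (0:ℝ)..t, (w s - d)) = φ (u, t) - φ (u, 0) - t * d := fun t => by
    rw [intervalIntegral.integral_sub (hwc.intervalIntegrable _ _) (by simp), h_int]
    simp
  have hφ0 := abs_le.1 (hA (u, 0))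
  have hφ1 := abs_le.1 (hA (u, 1))
  have hd2 : |d| ≤ 2 * A := abs_le.2 (by constructor <;> linarith)
  have hτ : ∀ i, ContractsPrimitives (2 / b) fun y => Int.fract (b * y + √(baseIter a i x)) :=
    fun i => contractsPrimitives_affine (by linarith) _
  have key := abs_integral_seqComp_le hρb hτ n (fun s => w s - d) (4 * A)
    (hwc.measurable.sub_const d)
    ⟨K + |d|, fun t => (abs_sub _ _).trans (by gcongr; exact hwK _)⟩
    (by rw [hsub]; ring) (fun t ht => by
      rw [hsub]
      have h1 := abs_le.1 (hA (u, t))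
      have h2 : |t * d| ≤ 2 * A := by
        rw [abs_mul, abs_of_nonneg ht.1]
        exact (mul_le_of_le_one_left (abs_nonneg _) ht.2).trans hd2
      have h3 := abs_le.1 h2
      exact abs_le.2 (by constructor <;> linarith))
  have hcomp : IntervalIntegrable (fun y => w (fibIter a b x n y)) volume 0 1 :=
    intervalIntegrable_of_bounded
      (hwc.measurable.comp (measurable_seqComp (fun i => (hτ i).1) n)) (fun t => hwK _) _ _
  have e : (∫ y in (0:ℝ)..1, w (fibIter a b x n y))
      = (∫ y in (0:ℝ)..1, (w (fibIter a b x n y) - d)) + d := by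
    rw [intervalIntegral.integral_sub hcomp (by simp)]
    simp
  change |∫ y in (0:ℝ)..1, w (fibIter a b x n y)| ≤ _
  rw [e]
  refine (abs_add_le _ _).trans ((add_le_add key hd2).trans (le_of_eq ?_))
  ring

/-! ### Cutting off near the boundary of the square -/

/-- A smooth cutoff, equal to `1` where `2 * δ ≤ t * (1 - t)` and to `0` where
`t * (1 - t) ≤ δ`. -/
def cutoff (δ t : ℝ) : ℝ := Real.smoothTransition (t * (1 - t) / δ - 1)

lemma contDiff_cutoff (δ : ℝ) : ContDiff ℝ 1 (cutoff δ) :=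
  Real.smoothTransition.contDiff.comp (by fun_prop)

lemma cutoff_nonneg (δ t : ℝ) : 0 ≤ cutoff δ t := Real.smoothTransition.nonneg _

lemma cutoff_le_one (δ t : ℝ) : cutoff δ t ≤ 1 := Real.smoothTransition.le_one _

lemma mem_Icc_of_cutoff_ne_zero {δ t : ℝ} (hδ : 0 < δ) (h : cutoff δ t ≠ 0) :
    t ∈ Icc δ (1 - δ) := by
  have h1 : 0 < t * (1 - t) / δ - 1 := by
    by_contra hc
    exact h (Real.smoothTransition.zero_of_nonpos (not_lt.1 hc))
  have h2 : δ < t * (1 - t) := by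
    have : 1 < t * (1 - t) / δ := by linarith
    rwa [one_lt_div hδ] at this
  have h3 : 0 < t := by nlinarith
  have h4 : t < 1 := by nlinarith
  constructor <;> nlinarith

lemma cutoff_eventuallyEq_one {δ t : ℝ} (hδ : 0 < δ) (h : 2 * δ < t * (1 - t)) :
    cutoff δ =ᶠ[𝓝 t] fun _ => 1 := by
  have : Continuous fun s : ℝ => s * (1 - s) := by fun_prop
  filter_upwards [this.continuousAt.eventually (lt_mem_nhds h)] with s hs
  refine Real.smoothTransition.one_of_one_le ?_
  have : 2 ≤ s * (1 - s) / δ := by rw [le_div_iff₀ hδ]; exact hs.le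
  linarith

lemma exists_abs_deriv_cutoff_mul_le :
    ∃ M, ∀ δ > 0, ∀ t ∈ Ioo (0:ℝ) 1, |deriv (cutoff δ) t| * (t * (1 - t)) ≤ M := by
  have hs : ContDiff ℝ 1 Real.smoothTransition := Real.smoothTransition.contDiff
  obtain ⟨M, hM⟩ := (isCompact_Icc (a := (-1:ℝ)) (b := 1)).exists_bound_of_continuousOn
    (hs.continuous_deriv le_rfl).continuousOn
  have hM0 : 0 ≤ M := (norm_nonneg _).trans (hM 0 (by simp))
  refine ⟨2 * M, fun δ hδ t ht => ?_⟩
  have hβ : 0 ≤ t * (1 - t) := mul_nonneg ht.1.le (by linarith [ht.2])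
  rcases lt_or_ge (2 * δ) (t * (1 - t)) with h | h
  · rw [(cutoff_eventuallyEq_one hδ h).deriv_eq]
    simpa using hM0
  · have hd : HasDerivAt (cutoff δ)
        (deriv Real.smoothTransition (t * (1 - t) / δ - 1) * ((1 - 2 * t) / δ)) t := by
      have h1 : HasDerivAt (fun s : ℝ => s * (1 - s) / δ - 1) ((1 - 2 * t) / δ) t := by
        refine HasDerivAt.congr_deriv
          ((((hasDerivAt_id' t).mul ((hasDerivAt_id' t).const_sub 1)).div_const δ).sub_const 1) ?_
        ring
      exact ((hs.differentiable one_ne_zero).differentiableAt.hasDerivAt).comp t h1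
    have h2 : |deriv Real.smoothTransition (t * (1 - t) / δ - 1)| ≤ M := by
      refine hM _ ⟨by have := div_nonneg hβ hδ.le; linarith, ?_⟩
      have : t * (1 - t) / δ ≤ 2 := by rwa [div_le_iff₀ hδ]
      linarith
    have h3 : |1 - 2 * t| ≤ 1 := abs_le.2 (by constructor <;> linarith [ht.1, ht.2])
    rw [hd.deriv, abs_mul, abs_div, abs_of_pos hδ]
    calc _ ≤ M * (1 / δ) * (2 * δ) := by gcongr
      _ = 2 * M := by field_simp

/-- `φ` is `C¹` and vanishes outside `[δ, 1 - δ]²`. -/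
def IsInner (δ : ℝ) (φ : ℝ × ℝ → ℝ) : Prop :=
  ContDiff ℝ 1 φ ∧ ∀ p, φ p ≠ 0 → p.1 ∈ Icc δ (1 - δ) ∧ p.2 ∈ Icc δ (1 - δ)

/-- `G` is `C¹`, vanishes on the two vertical sides of the unit square, and is bounded by `A` on
the square. -/
def IsLateral (A : ℝ) (G : ℝ × ℝ → ℝ) : Prop :=
  ContDiff ℝ 1 G ∧ (∀ y, G (0, y) = 0) ∧ (∀ y, G (1, y) = 0) ∧
    ∀ x ∈ Icc (0:ℝ) 1, ∀ y ∈ Icc (0:ℝ) 1, |G (x, y)| ≤ A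

/-- The variation of `ν` in the first coordinate, inside the square, is at most `S`. -/
def FstVariationLe (S : ℝ) (ν : Measure (ℝ × ℝ)) : Prop :=
  ∀ A G, IsLateral A G → |∫ p, fderiv ℝ G p (1, 0) ∂ν| ≤ S * A

lemma exists_abs_fderiv_le_on_square {G : ℝ × ℝ → ℝ} (hG : ContDiff ℝ 1 G) (v : ℝ × ℝ) :
    ∃ K, ∀ x ∈ Icc (0:ℝ) 1, ∀ y ∈ Icc (0:ℝ) 1, |fderiv ℝ G (x, y) v| ≤ K := by
  obtain ⟨K, hK⟩ := ((isCompact_Icc (a := (0:ℝ)) (b := 1)).prod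
    (isCompact_Icc (a := (0:ℝ)) (b := 1))).exists_bound_of_continuousOn
    (continuous_fderiv_apply_const hG v).continuousOn
  exact ⟨K, fun x hx y hy => hK (x, y) ⟨hx, hy⟩⟩

lemma IsLateral.abs_le_mul {A : ℝ} {G : ℝ × ℝ → ℝ} (hG : IsLateral A G) {K : ℝ}
    (hK : ∀ x ∈ Icc (0:ℝ) 1, ∀ y ∈ Icc (0:ℝ) 1, |fderiv ℝ G (x, y) (1, 0)| ≤ K)
    {x y : ℝ} (hx : x ∈ Icc (0:ℝ) 1) (hy : y ∈ Icc (0:ℝ) 1) :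
    |G (x, y)| ≤ 2 * K * (x * (1 - x)) := by
  have hK0 : 0 ≤ K := (abs_nonneg _).trans (hK x hx y hy)
  have hmv : ∀ p ∈ Icc (0:ℝ) 1, ∀ q ∈ Icc (0:ℝ) 1, |G (q, y) - G (p, y)| ≤ K * |q - p| :=
    fun p hp q hq => (convex_Icc (0:ℝ) 1).norm_image_sub_le_of_norm_hasDerivWithin_le
      (f := fun s => G (s, y)) (fun s _ => (hasDerivAt_fst hG.1 s y).hasDerivWithinAt)
      (fun s hs => hK s hs y hy) hp hq
  have h0 := hmv 0 (by simp) x hx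
  have h1 := hmv 1 (by simp) x hx
  rw [hG.2.1, sub_zero, sub_zero, abs_of_nonneg hx.1] at h0
  rw [hG.2.2.1, sub_zero, abs_sub_comm x 1, abs_of_nonneg (sub_nonneg.2 hx.2)] at h1
  have hx0 := hx.1
  have hx1 := hx.2
  rcases le_total x (1 / 2) with h | h
  · have : K * x * 1 ≤ K * x * (2 * (1 - x)) := by gcongr; linarith
    linarith
  · have : K * (1 - x) * 1 ≤ K * (1 - x) * (2 * x) :=
      mul_le_mul_of_nonneg_left (by linarith) (mul_nonneg hK0 (by linarith))
    linarith

lemma fstVariationLe_of_inner {S : ℝ} {ν : Measure (ℝ × ℝ)} [IsFiniteMeasure ν]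
    (hν : ∀ᵐ p ∂ν, p ∈ Ioo (0:ℝ) 1 ×ˢ Ioo (0:ℝ) 1)
    (h : ∀ A φ, ∀ δ > 0, IsInner δ φ → (∀ p, |φ p| ≤ A) →
      |∫ p, fderiv ℝ φ p (1, 0) ∂ν| ≤ S * A) : FstVariationLe S ν := by
  intro A G hG
  obtain ⟨K, hK⟩ := exists_abs_fderiv_le_on_square hG.1 (1, 0)
  obtain ⟨M, hM⟩ := exists_abs_deriv_cutoff_mul_le
  have hK0 : 0 ≤ K := (abs_nonneg _).trans (hK 0 (by simp) 0 (by simp))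
  have hA0 : 0 ≤ A := (abs_nonneg _).trans (hG.2.2.2 0 (by simp) 0 (by simp))
  set δ : ℕ → ℝ := fun j => 1 / ((j : ℝ) + 1) with hδdef
  have hδ : ∀ j, 0 < δ j := fun j => Nat.one_div_pos_of_nat
  have hδlim : Tendsto δ atTop (𝓝 0) := tendsto_one_div_add_atTop_nhds_zero_nat
  set φ : ℕ → ℝ × ℝ → ℝ := fun j p => cutoff (δ j) p.1 * cutoff (δ j) p.2 * G p with hφdef
  have hφ : ∀ j, IsInner (δ j) (φ j) := fun j =>
    ⟨(((contDiff_cutoff _).comp contDiff_fst).mul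
      ((contDiff_cutoff _).comp contDiff_snd)).mul hG.1, fun p hp => by
      simp only [hφdef, mul_ne_zero_iff] at hp
      exact ⟨mem_Icc_of_cutoff_ne_zero (hδ j) hp.1.1, mem_Icc_of_cutoff_ne_zero (hδ j) hp.1.2⟩⟩
  have hIcc : ∀ j {t}, t ∈ Icc (δ j) (1 - δ j) → t ∈ Icc (0:ℝ) 1 := fun j t ht =>
    ⟨(hδ j).le.trans ht.1, ht.2.trans (by linarith [hδ j])⟩
  have hφA : ∀ j p, |φ j p| ≤ A := fun j p => by
    by_cases hp : φ j p = 0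
    · simpa [hp] using hA0
    · obtain ⟨h1, h2⟩ := (hφ j).2 p hp
      have hGp := hG.2.2.2 p.1 (hIcc j h1) p.2 (hIcc j h2)
      simp only [hφdef, abs_mul, abs_of_nonneg (cutoff_nonneg _ _)]
      have hcc : cutoff (δ j) p.1 * cutoff (δ j) p.2 ≤ 1 :=
        mul_le_one₀ (cutoff_le_one _ _) (cutoff_nonneg _ _) (cutoff_le_one _ _)
      exact (mul_le_of_le_one_left (abs_nonneg _) hcc).trans hGp
  have hder : ∀ j p, fderiv ℝ (φ j) p (1, 0) =
      deriv (cutoff (δ j)) p.1 * cutoff (δ j) p.2 * G p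
        + cutoff (δ j) p.1 * cutoff (δ j) p.2 * fderiv ℝ G p (1, 0) := fun j p =>
    (hasDerivAt_fst (hφ j).1 p.1 p.2).unique
      (((((contDiff_cutoff (δ j)).differentiable one_ne_zero).differentiableAt.hasDerivAt).mul_const
        (cutoff (δ j) p.2)).mul (hasDerivAt_fst hG.1 p.1 p.2))
  have hlim : Tendsto (fun j => ∫ p, fderiv ℝ (φ j) p (1, 0) ∂ν) atTop
      (𝓝 (∫ p, fderiv ℝ G p (1, 0) ∂ν)) := by
    refine tendsto_integral_of_dominated_convergence (fun _ => 2 * K * M + K)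
      (fun j => (continuous_fderiv_apply_const (hφ j).1 _).aestronglyMeasurable)
      (integrable_const _) (fun j => ?_) ?_
    · filter_upwards [hν] with p hp
      have hx : p.1 ∈ Icc (0:ℝ) 1 := Ioo_subset_Icc_self hp.1
      have hy : p.2 ∈ Icc (0:ℝ) 1 := Ioo_subset_Icc_self hp.2
      have hGp : |G p| ≤ 2 * K * (p.1 * (1 - p.1)) := hG.abs_le_mul hK hx hy
      have hdG : |fderiv ℝ G p (1, 0)| ≤ K := hK p.1 hx p.2 hy
      have hMp := hM (δ j) (hδ j) p.1 hp.1
      rw [hder, Real.norm_eq_abs]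
      refine (abs_add_le _ _).trans ?_
      simp only [abs_mul, abs_of_nonneg (cutoff_nonneg _ _)]
      have h1 : |deriv (cutoff (δ j)) p.1| * cutoff (δ j) p.2 * |G p|
          ≤ |deriv (cutoff (δ j)) p.1| * 1 * (2 * K * (p.1 * (1 - p.1))) := by
        gcongr
        exact cutoff_le_one _ _
      have h2 : cutoff (δ j) p.1 * cutoff (δ j) p.2 * |fderiv ℝ G p (1, 0)| ≤ K :=
        (mul_le_of_le_one_left (abs_nonneg _) (mul_le_one₀ (cutoff_le_one _ _)
          (cutoff_nonneg _ _) (cutoff_le_one _ _))).trans hdG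
      have h3 : 2 * K * (|deriv (cutoff (δ j)) p.1| * (p.1 * (1 - p.1))) ≤ 2 * K * M := by gcongr
      linarith
    · filter_upwards [hν] with p hp
      have hev : ∀ t ∈ Ioo (0:ℝ) 1, ∀ᶠ j in atTop, cutoff (δ j) =ᶠ[𝓝 t] fun _ => 1 := by
        intro t ht
        have hpos : 0 < t * (1 - t) := mul_pos ht.1 (sub_pos.2 ht.2)
        have hl : Tendsto (fun j => 2 * δ j) atTop (𝓝 0) := by simpa using hδlim.const_mul 2
        filter_upwards [hl.eventually (gt_mem_nhds hpos)] with j hj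
        exact cutoff_eventuallyEq_one (hδ j) hj
      refine tendsto_const_nhds.congr' ?_
      filter_upwards [hev p.1 hp.1, hev p.2 hp.2] with j h1 h2
      rw [hder, h1.deriv_eq, h1.eq_of_nhds, h2.eq_of_nhds]
      simp
  exact le_of_tendsto hlim.abs (Eventually.of_forall fun j => h A (φ j) (δ j) (hδ j) (hφ j) (hφA j))

/-! ### The Lasota–Yorke inequality in the first coordinate -/

lemma sum_comp_sub_natCast {g : ℝ → ℝ} (hg : ∀ t, t ∉ Ioo (0:ℝ) 1 → g t = 0) {N : ℕ} {t : ℝ}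
    (h0 : 0 ≤ t) (hN : t < N) : ∑ k ∈ Finset.range N, g (t - k) = g (Int.fract t) := by
  rw [Finset.sum_eq_single ⌊t⌋₊]
  · rw [Int.fract, ← natCast_floor_eq_intCast_floor h0]
  · intro k _ hk
    refine hg _ fun hmem => hk ?_
    exact ((Nat.floor_eq_iff h0).2 ⟨by linarith [hmem.1], by linarith [hmem.2]⟩).symm
  · intro h
    exact absurd (Finset.mem_range.2 ((Nat.floor_lt h0).2 hN)) h

/-- Superposition of the translates of `f` by the integer points of `[0, N) × [0, M)`. -/
def tile (N M : ℕ) (f : ℝ × ℝ → ℝ) (p : ℝ × ℝ) : ℝ :=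
  ∑ k ∈ Finset.range N, ∑ l ∈ Finset.range M, f (p.1 - k, p.2 - l)

lemma tile_eq {N M : ℕ} {f : ℝ × ℝ → ℝ} (hf : ∀ p, p ∉ Ioo (0:ℝ) 1 ×ˢ Ioo (0:ℝ) 1 → f p = 0)
    {u v : ℝ} (hu : 0 ≤ u) (huN : u < N) (hv : 0 ≤ v) (hvM : v < M) :
    tile N M f (u, v) = f (Int.fract u, Int.fract v) := by
  unfold tile
  have h1 : ∀ k : ℕ, ∑ l ∈ Finset.range M, f (u - k, v - l) = f (u - k, Int.fract v) := fun k =>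
    sum_comp_sub_natCast (g := fun s => f (u - k, s)) (fun t ht => hf _ fun h => ht h.2) hv hvM
  simp_rw [h1]
  exact sum_comp_sub_natCast (g := fun s => f (s, Int.fract v)) (fun t ht => hf _ fun h => ht h.1)
    hu huN

lemma contDiff_tile (N M : ℕ) {φ : ℝ × ℝ → ℝ} (hφ : ContDiff ℝ 1 φ) : ContDiff ℝ 1 (tile N M φ) :=
  ContDiff.sum fun _ _ => ContDiff.sum fun _ _ => hφ.comp (by fun_prop)

lemma fderiv_tile (N M : ℕ) {φ : ℝ × ℝ → ℝ} (hφ : ContDiff ℝ 1 φ) (v p : ℝ × ℝ) :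
    fderiv ℝ (tile N M φ) p v = tile N M (fun q => fderiv ℝ φ q v) p := by
  have hd : ∀ k l : ℕ, HasFDerivAt (fun q : ℝ × ℝ => φ (q.1 - k, q.2 - l))
      (fderiv ℝ φ (p.1 - k, p.2 - l)) p := fun k l => by
    have h := (hφ.differentiable one_ne_zero).differentiableAt.hasFDerivAt
      (x := p - ((k : ℝ), (l : ℝ)))
    exact (h.comp p ((hasFDerivAt_id p).sub_const _)).congr_fderiv (ContinuousLinearMap.comp_id _)
  have : HasFDerivAt (tile N M φ) (∑ k ∈ Finset.range N, ∑ l ∈ Finset.range M,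
      fderiv ℝ φ (p.1 - k, p.2 - l)) p :=
    HasFDerivAt.fun_sum fun k _ => HasFDerivAt.fun_sum fun l _ => hd k l
  rw [this.fderiv]
  simp [tile]

lemma IsInner.eq_zero {δ : ℝ} (hδ : 0 < δ) {φ : ℝ × ℝ → ℝ} (hφ : IsInner δ φ) (p : ℝ × ℝ)
    (hp : p ∉ Ioo (0:ℝ) 1 ×ˢ Ioo (0:ℝ) 1) : φ p = 0 := by
  by_contra h
  obtain ⟨h1, h2⟩ := hφ.2 p h
  exact hp ⟨⟨hδ.trans_le h1.1, h1.2.trans_lt (by linarith)⟩,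
    ⟨hδ.trans_le h2.1, h2.2.trans_lt (by linarith)⟩⟩

lemma IsInner.support_subset {δ : ℝ} {φ : ℝ × ℝ → ℝ} (hφ : IsInner δ φ) :
    Function.support φ ⊆ Icc δ (1 - δ) ×ˢ Icc δ (1 - δ) := fun p hp => hφ.2 p hp

lemma IsInner.hasCompactSupport {δ : ℝ} {φ : ℝ × ℝ → ℝ} (hφ : IsInner δ φ) :
    HasCompactSupport φ :=
  HasCompactSupport.of_support_subset_isCompact (isCompact_Icc.prod isCompact_Icc)
    hφ.support_subset

lemma IsInner.fderiv_eq_zero {δ : ℝ} (hδ : 0 < δ) {φ : ℝ × ℝ → ℝ} (hφ : IsInner δ φ)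
    (v p : ℝ × ℝ) (hp : p ∉ Ioo (0:ℝ) 1 ×ˢ Ioo (0:ℝ) 1) : fderiv ℝ φ p v = 0 := by
  by_contra h
  have h1 : p ∈ tsupport φ :=
    support_fderiv_subset ℝ fun h0 : fderiv ℝ φ p = 0 => h (by rw [h0]; rfl)
  have h2 : p ∈ Icc δ (1 - δ) ×ˢ Icc δ (1 - δ) :=
    closure_minimal hφ.support_subset (isClosed_Icc.prod isClosed_Icc) h1
  exact hp ⟨⟨hδ.trans_le h2.1.1, h2.1.2.trans_lt (by linarith)⟩,
    ⟨hδ.trans_le h2.2.1, h2.2.2.trans_lt (by linarith)⟩⟩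

/-- The lift of a function on the plane by `(x, y) ↦ (a√x, by + √x)`, weighted by the inverse of
the derivative of `x ↦ a√x`. -/
def liftPsi (a b : ℝ) (Φ : ℝ × ℝ → ℝ) (p : ℝ × ℝ) : ℝ :=
  2 * √p.1 / a * Φ (a * √p.1, b * p.2 + √p.1)

lemma contDiff_liftPsi {a b δ : ℝ} (hδ : 0 < δ) {Φ : ℝ × ℝ → ℝ}
    (hΦ : ContDiff ℝ 1 Φ) (h0 : ∀ p : ℝ × ℝ, p.1 < δ → Φ p = 0) :
    ContDiff ℝ 1 (liftPsi a b Φ) := by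
  refine contDiff_iff_contDiffAt.2 fun p => ?_
  rcases lt_or_ge 0 p.1 with hp | hp
  · have hs : ContDiffAt ℝ 1 (fun q : ℝ × ℝ => √q.1) p :=
      (Real.contDiffAt_sqrt hp.ne').comp p contDiffAt_fst
    have h1 : ContDiffAt ℝ 1 (fun q : ℝ × ℝ => (a * √q.1, b * q.2 + √q.1)) p :=
      (contDiffAt_const.mul hs).prodMk ((contDiffAt_const.mul contDiffAt_snd).add hs)
    exact ((contDiffAt_const.mul hs).div_const a).mul (hΦ.contDiffAt.comp p h1)
  · have hc : Continuous fun q : ℝ × ℝ => a * √q.1 := by fun_prop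
    have hev : ∀ᶠ q : ℝ × ℝ in 𝓝 p, a * √q.1 < δ :=
      hc.continuousAt.eventually (gt_mem_nhds (by simpa [Real.sqrt_eq_zero'.2 hp] using hδ))
    refine (contDiffAt_const (c := (0:ℝ))).congr_of_eventuallyEq ?_
    filter_upwards [hev] with q hq
    rw [liftPsi, h0 _ hq, mul_zero]

lemma hasDerivAt_liftPsi {a : ℝ} (b : ℝ) (ha : 0 < a) {Φ : ℝ × ℝ → ℝ} (hΦ : ContDiff ℝ 1 Φ)
    {x : ℝ} (hx : 0 < x) (y : ℝ) :
    HasDerivAt (fun s => liftPsi a b Φ (s, y))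
      (Φ (a * √x, b * y + √x) * (√x)⁻¹ / a + fderiv ℝ Φ (a * √x, b * y + √x) (1, 0)
        + fderiv ℝ Φ (a * √x, b * y + √x) (0, 1) / a) x := by
  have hs : HasDerivAt (fun s => √s) (1 / (2 * √x)) x := Real.hasDerivAt_sqrt hx.ne'
  have h1 : HasDerivAt (fun s => (a * √s, b * y + √s)) (a * (1 / (2 * √x)), 1 / (2 * √x)) x :=
    (hs.const_mul a).prodMk (hs.const_add (b * y))
  have h2 := ((hΦ.differentiable one_ne_zero).differentiableAt.hasFDerivAt
    (x := (a * √x, b * y + √x))).comp_hasDerivAt x h1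
  have h3 := ((hs.const_mul 2).div_const a).mul h2
  refine HasDerivAt.congr_deriv h3 ?_
  have hv : ((a * (1 / (2 * √x)), 1 / (2 * √x)) : ℝ × ℝ)
      = (a / (2 * √x)) • ((1, 0) : ℝ × ℝ) + (1 / (2 * √x)) • ((0, 1) : ℝ × ℝ) := by
    ext <;> simp; ring
  rw [hv, map_add, map_smul, map_smul]
  have : √x ≠ 0 := (Real.sqrt_pos.2 hx).ne'
  simp only [Function.comp, smul_eq_mul]
  field_simp
  ring

lemma FstVariationLe.map_skew {ν : Measure (ℝ × ℝ)} [IsProbabilityMeasure ν] (ha : 0 < a)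
    (hb : 0 < b) {S R C : ℝ} (hS : FstVariationLe S ν)
    (hν : ∀ᵐ p ∂ν, p ∈ Ioo (0:ℝ) 1 ×ˢ Ioo (0:ℝ) 1)
    (hν' : ∀ᵐ p ∂ν.map (skew a b), p ∈ Ioo (0:ℝ) 1 ×ˢ Ioo (0:ℝ) 1)
    (hR : Integrable (fun p : ℝ × ℝ => (√p.1)⁻¹) ν) (hR' : ∫ p, (√p.1)⁻¹ ∂ν ≤ R)
    (hC : ∀ A φ, ContDiff ℝ 1 φ → HasCompactSupport φ → (∀ p, |φ p| ≤ A) →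
      |∫ p, fderiv ℝ φ (skew a b p) (0, 1) ∂ν| ≤ C * A) :
    FstVariationLe (4 / a * S + (2 + R + C) / a) (ν.map (skew a b)) := by
  have hT := measurable_skew a b
  have : IsProbabilityMeasure (ν.map (skew a b)) :=
    Measure.isProbabilityMeasure_map hT.aemeasurable
  refine fstVariationLe_of_inner hν' fun A φ δ hδ hφ hA => ?_
  have hA0 : 0 ≤ A := (abs_nonneg _).trans (hA 0)
  have hφs := hφ.hasCompactSupport
  obtain ⟨N, hN⟩ := exists_nat_gt a
  obtain ⟨M, hM⟩ := exists_nat_gt (b + 1)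
  set Φ := tile N M φ with hΦdef
  have hΦ : ContDiff ℝ 1 Φ := contDiff_tile N M hφ.1
  have hrange : ∀ x ∈ Icc (0:ℝ) 1, ∀ y ∈ Icc (0:ℝ) 1, 0 ≤ a * √x ∧ a * √x < N ∧
      0 ≤ b * y + √x ∧ b * y + √x < M := fun x hx y hy => by
    have h0 := Real.sqrt_nonneg x
    have h1 : √x ≤ 1 := Real.sqrt_le_one.2 hx.2
    have hy0 := hy.1
    have h2 : a * √x ≤ a := mul_le_of_le_one_right ha.le h1
    have h3 : b * y ≤ b := mul_le_of_le_one_right hb.le hy.2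
    refine ⟨by positivity, by linarith, by positivity, by linarith⟩
  have htile : ∀ f : ℝ × ℝ → ℝ, (∀ p, p ∉ Ioo (0:ℝ) 1 ×ˢ Ioo (0:ℝ) 1 → f p = 0) →
      ∀ x ∈ Icc (0:ℝ) 1, ∀ y ∈ Icc (0:ℝ) 1,
        tile N M f (a * √x, b * y + √x) = f (skew a b (x, y)) := fun f hf x hx y hy => by
    obtain ⟨h1, h2, h3, h4⟩ := hrange x hx y hy
    exact tile_eq hf h1 h2 h3 h4
  have hΦ0 : ∀ p : ℝ × ℝ, p.1 < δ → Φ p = 0 := fun p hp =>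
    Finset.sum_eq_zero fun k _ => Finset.sum_eq_zero fun l _ => by
      by_contra h
      have h1 := (hφ.2 _ h).1.1
      have h2 : (0:ℝ) ≤ k := Nat.cast_nonneg k
      dsimp only at h1
      linarith
  set ψ := liftPsi a b Φ with hψdef
  have hψ : ContDiff ℝ 1 ψ := contDiff_liftPsi hδ hΦ hΦ0
  have hψA : ∀ x ∈ Icc (0:ℝ) 1, ∀ y ∈ Icc (0:ℝ) 1, |ψ (x, y)| ≤ 2 / a * A :=
    fun x hx y hy => by
      have h0 := Real.sqrt_nonneg x
      have h1 : √x ≤ 1 := Real.sqrt_le_one.2 hx.2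
      simp only [hψdef, liftPsi, hΦdef, htile φ (hφ.eq_zero hδ) x hx y hy, abs_mul, abs_div,
        abs_of_pos ha, abs_of_nonneg h0, abs_two]
      calc _ ≤ 2 * 1 / a * A := by gcongr; exact hA _
        _ = _ := by ring
  set G : ℝ × ℝ → ℝ := fun p => ψ p - p.1 * ψ (1, p.2) with hGdef
  have hψ1 : ContDiff ℝ 1 fun p : ℝ × ℝ => ψ (1, p.2) := hψ.comp (by fun_prop)
  have hG : IsLateral (4 / a * A) G := by
    refine ⟨hψ.sub (contDiff_fst.mul hψ1), fun y => by simp [hGdef, hψdef, liftPsi],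
      fun y => by simp [hGdef], fun x hx y hy => ?_⟩
    have h1 := hψA x hx y hy
    have h2 := hψA 1 (by simp) y hy
    have h3 : |x * ψ (1, y)| ≤ 2 / a * A := by
      rw [abs_mul, abs_of_nonneg hx.1]
      exact (mul_le_of_le_one_left (abs_nonneg _) hx.2).trans h2
    have e : 4 / a * A = 2 / a * A + 2 / a * A := by ring
    exact (abs_sub _ _).trans (by linarith)
  have hderiv : ∀ p ∈ Ioo (0:ℝ) 1 ×ˢ Ioo (0:ℝ) 1, fderiv ℝ φ (skew a b p) (1, 0) =
      fderiv ℝ G p (1, 0) + ψ (1, p.2) - (φ (skew a b p) * (√p.1)⁻¹) / a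
        - fderiv ℝ φ (skew a b p) (0, 1) / a := by
    rintro ⟨x, y⟩ hp
    have hx : x ∈ Icc (0:ℝ) 1 := Ioo_subset_Icc_self hp.1
    have hy : y ∈ Icc (0:ℝ) 1 := Ioo_subset_Icc_self hp.2
    have h1 := hasDerivAt_liftPsi b ha hΦ hp.1.1 y
    rw [hΦdef, fderiv_tile N M hφ.1, fderiv_tile N M hφ.1,
      htile _ (hφ.fderiv_eq_zero hδ _) x hx y hy, htile _ (hφ.fderiv_eq_zero hδ _) x hx y hy,
      htile φ (hφ.eq_zero hδ) x hx y hy] at h1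
    have h2 := (hasDerivAt_fst hG.1 x y).unique
      (h1.sub ((hasDerivAt_id' x).mul_const (ψ (1, y))))
    rw [h2]
    ring
  obtain ⟨K₁, hK₁⟩ := exists_abs_fderiv_apply_le hφ.1 hφs (0, 1)
  obtain ⟨K₂, hK₂⟩ := exists_abs_fderiv_le_on_square hG.1 (1, 0)
  have i1 : Integrable (fun p => fderiv ℝ G p (1, 0)) ν :=
    Integrable.of_bound (continuous_fderiv_apply_const hG.1 _).aestronglyMeasurable K₂ <| by
      filter_upwards [hν] with p hp
      exact hK₂ p.1 (Ioo_subset_Icc_self hp.1) p.2 (Ioo_subset_Icc_self hp.2)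
  have hψb : ∀ᵐ p ∂ν, ‖ψ (1, p.2)‖ ≤ 2 / a * A := by
    filter_upwards [hν] with p hp
    exact hψA 1 (by simp) p.2 (Ioo_subset_Icc_self hp.2)
  have i2 : Integrable (fun p : ℝ × ℝ => ψ (1, p.2)) ν :=
    Integrable.of_bound hψ1.continuous.aestronglyMeasurable _ hψb
  have hφT : Measurable fun p => φ (skew a b p) := hφ.1.continuous.measurable.comp hT
  have i3 : Integrable (fun p => φ (skew a b p) * (√p.1)⁻¹) ν :=
    hR.bdd_mul hφT.aestronglyMeasurable (Eventually.of_forall fun p => hA _)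
  have i4 : Integrable (fun p => fderiv ℝ φ (skew a b p) (0, 1)) ν :=
    integrable_of_abs_le ((continuous_fderiv_apply_const hφ.1 _).measurable.comp hT)
      fun p => hK₁ _
  have i12 : Integrable (fun p => fderiv ℝ G p (1, 0) + ψ (1, p.2)) ν := i1.add i2
  rw [integral_map hT.aemeasurable
    (continuous_fderiv_apply_const hφ.1 _).aestronglyMeasurable,
    integral_congr_ae (hν.mono hderiv), integral_sub _ (i4.div_const a),
    integral_sub i12 (i3.div_const a), integral_add i1 i2, integral_div, integral_div]
  swap
  · exact i12.sub (i3.div_const a)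
  have b1 := hS _ _ hG
  have b2 : |∫ p, ψ (1, p.2) ∂ν| ≤ 2 / a * A := by
    simpa using norm_integral_le_of_norm_le_const hψb
  have b3 : |∫ p, φ (skew a b p) * (√p.1)⁻¹ ∂ν| ≤ A * R := by
    have h1 : ‖∫ p, φ (skew a b p) * (√p.1)⁻¹ ∂ν‖ ≤ ∫ p, A * (√p.1)⁻¹ ∂ν :=
      norm_integral_le_of_norm_le (hR.const_mul A) <| Eventually.of_forall fun p => by
        have h0 := inv_nonneg.2 (Real.sqrt_nonneg p.1)
        rw [norm_mul, Real.norm_of_nonneg h0]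
        exact mul_le_mul_of_nonneg_right (hA _) h0
    rw [integral_const_mul] at h1
    exact h1.trans (mul_le_mul_of_nonneg_left hR' hA0)
  have b4 := hC A φ hφ.1 hφs hA
  have b3' : |(∫ p, φ (skew a b p) * (√p.1)⁻¹ ∂ν) / a| ≤ A * R / a := by
    rw [abs_div, abs_of_pos ha]; gcongr
  have b4' : |(∫ p, fderiv ℝ φ (skew a b p) (0, 1) ∂ν) / a| ≤ C * A / a := by
    rw [abs_div, abs_of_pos ha]; gcongr
  have e : (4 / a * S + (2 + R + C) / a) * A
      = S * (4 / a * A) + 2 / a * A + A * R / a + C * A / a := by ring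
  rw [e]
  refine (abs_sub _ _).trans (add_le_add ((abs_sub _ _).trans (add_le_add
    ((abs_add_le _ _).trans (add_le_add b1 b2)) b3')) b4')

/-! ### Uniform bounds along the orbit of Lebesgue measure -/

/-- The image of Lebesgue measure on the unit square under the `n`-th iterate of `skew a b`. -/
def pushed (a b : ℝ) (n : ℕ) : Measure (ℝ × ℝ) := unitSq.map (skew a b)^[n]

instance (a b : ℝ) (n : ℕ) : IsProbabilityMeasure (pushed a b n) :=
  Measure.isProbabilityMeasure_map ((measurable_skew a b).iterate n).aemeasurable

lemma pushed_zero (a b : ℝ) : pushed a b 0 = unitSq := by simp [pushed]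

lemma pushed_succ (a b : ℝ) (n : ℕ) : pushed a b (n + 1) = (pushed a b n).map (skew a b) := by
  rw [pushed, pushed, Measure.map_map (measurable_skew a b) ((measurable_skew a b).iterate n),
    Function.iterate_succ']

lemma integral_pushed (a b : ℝ) (n : ℕ) {g : ℝ × ℝ → ℝ} (hg : Measurable g) :
    ∫ p, g p ∂pushed a b n = ∫ p, g ((skew a b)^[n] p) ∂unitSq :=
  integral_map ((measurable_skew a b).iterate n).aemeasurable hg.aestronglyMeasurable

lemma ae_mem_of_le_smul {ν : Measure (ℝ × ℝ)} {K : ℝ≥0∞} (h : ν ≤ K • unitSq) :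
    ∀ᵐ p ∂ν, p ∈ Ioo (0:ℝ) 1 ×ˢ Ioo (0:ℝ) 1 :=
  (Measure.absolutelyContinuous_of_le_smul h).ae_le ae_unitSq_mem

lemma integrable_inv_sqrt_fst : Integrable (fun p : ℝ × ℝ => (√p.1)⁻¹) unitSq := by
  have h : IntervalIntegrable (fun x : ℝ => x ^ (-(1 / 2) : ℝ)) volume 0 1 :=
    intervalIntegral.intervalIntegrable_rpow' (by norm_num)
  rw [intervalIntegrable_iff_integrableOn_Ioo_of_le zero_le_one] at h
  have h2 : Integrable (fun x : ℝ => (√x)⁻¹) unitI := by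
    refine (integrable_congr ?_).1 h
    filter_upwards [ae_restrict_mem measurableSet_Ioo] with x hx
    rw [Real.sqrt_eq_rpow, Real.rpow_neg hx.1.le]
  exact h2.comp_fst unitI

lemma FstVariationLe.mono {S S' : ℝ} {ν : Measure (ℝ × ℝ)} (h : FstVariationLe S ν)
    (hS : S ≤ S') : FstVariationLe S' ν := fun A G hG =>
  (h A G hG).trans (mul_le_mul_of_nonneg_right hS
    ((abs_nonneg _).trans (hG.2.2.2 0 (by simp) 0 (by simp))))

lemma fstVariationLe_unitSq : FstVariationLe 0 unitSq := by
  intro A G hG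
  obtain ⟨K, hK⟩ := exists_abs_fderiv_le_on_square hG.1 (1, 0)
  have hc := continuous_fderiv_apply_const hG.1 (1, 0)
  have hi : Integrable (fun p => fderiv ℝ G p (1, 0)) unitSq :=
    Integrable.of_bound hc.aestronglyMeasurable K <| by
      filter_upwards [ae_unitSq_mem] with p hp
      exact hK p.1 (Ioo_subset_Icc_self hp.1) p.2 (Ioo_subset_Icc_self hp.2)
  have hy : ∀ y, ∫ x, fderiv ℝ G (x, y) (1, 0) ∂unitI = 0 := fun y => by
    rw [integral_unitI, intervalIntegral.integral_eq_sub_of_hasDerivAt (f := fun s => G (s, y))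
      (fun s _ => hasDerivAt_fst hG.1 s y)
      ((hc.comp (by fun_prop : Continuous fun s : ℝ => (s, y))).intervalIntegrable _ _),
      hG.2.1, hG.2.2.1, sub_zero]
  rw [unitSq, integral_prod_symm _ hi]
  simp [hy]

lemma exists_fstVariationLe_pushed (ha : 4 < a) (hb : 2 < b) :
    ∃ S, 0 ≤ S ∧ ∀ n, FstVariationLe S (pushed a b n) := by
  obtain ⟨K, hK, hle⟩ := exists_map_skew_iterate_le ha hb
  set R := K.toReal * ∫ p : ℝ × ℝ, (√p.1)⁻¹ ∂unitSq with hR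
  set C := 2 + 4 * (|2 / b| / (1 - 2 / b)) with hC
  have hpos : ∀ p : ℝ × ℝ, 0 ≤ (√p.1)⁻¹ := fun p => inv_nonneg.2 (Real.sqrt_nonneg p.1)
  have hR0 : 0 ≤ R := mul_nonneg ENNReal.toReal_nonneg (integral_nonneg hpos)
  have hC0 : 0 ≤ C := by
    have : 2 / b < 1 := by rw [div_lt_one] <;> linarith
    have := div_nonneg (abs_nonneg (2 / b)) (sub_pos.2 this).le
    positivity
  have hρ : 0 < 1 - 4 / a := by
    have : 4 / a < 1 := by rw [div_lt_one] <;> linarith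
    linarith
  have ha0 : 0 < a := by linarith
  set S := (2 + R + C) / a / (1 - 4 / a) with hS
  have hS0 : 0 ≤ S := by positivity
  have hfix : 4 / a * S + (2 + R + C) / a = S := by
    have : S * (1 - 4 / a) = (2 + R + C) / a := div_mul_cancel₀ _ hρ.ne'
    linarith
  have h_int : Integrable (fun p : ℝ × ℝ => (√p.1)⁻¹) (K • unitSq) :=
    integrable_inv_sqrt_fst.smul_measure hK
  refine ⟨S, hS0, fun n => ?_⟩
  induction n with
  | zero => rw [pushed_zero]; exact fstVariationLe_unitSq.mono hS0
  | succ n ih =>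
    rw [pushed_succ, ← hfix]
    refine FstVariationLe.map_skew ha0 (by linarith) ih (ae_mem_of_le_smul (hle n)) ?_
      (h_int.mono_measure (hle n)) ?_ fun A φ hφ hs hA => ?_
    · rw [← pushed_succ]
      exact ae_mem_of_le_smul (hle (n + 1))
    · calc _ ≤ ∫ p : ℝ × ℝ, (√p.1)⁻¹ ∂(K • unitSq) :=
            integral_mono_measure (hle n) (Eventually.of_forall hpos) h_int
        _ = R := by rw [integral_smul_measure, smul_eq_mul]
    · have hm : Measurable fun p => fderiv ℝ φ p (0, 1) :=
        (continuous_fderiv_apply_const hφ _).measurable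
      rw [integral_pushed a b n (g := fun p => fderiv ℝ φ (skew a b p) (0, 1))
        (hm.comp (measurable_skew a b))]
      simp_rw [← Function.iterate_succ_apply']
      exact abs_integral_fderiv_snd_le hb (n + 1) hφ hs hA

lemma FstVariationLe.abs_integral_fderiv_le {S : ℝ} {ν : Measure (ℝ × ℝ)} [IsProbabilityMeasure ν]
    (hS : FstVariationLe S ν) {φ : ℝ × ℝ → ℝ} (hφ : ContDiff ℝ 1 φ) (hs : HasCompactSupport φ)
    {A : ℝ} (hA : ∀ p, |φ p| ≤ A) :
    |∫ p, fderiv ℝ φ p (1, 0) ∂ν| ≤ (2 * S + 2) * A := by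
  have hc : ∀ s : ℝ, ContDiff ℝ 1 fun p : ℝ × ℝ => φ (s, p.2) := fun s => hφ.comp (by fun_prop)
  set G : ℝ × ℝ → ℝ := fun p => φ p - ((1 - p.1) * φ (0, p.2) + p.1 * φ (1, p.2)) with hGdef
  have hG : IsLateral (2 * A) G := by
    refine ⟨hφ.sub (((contDiff_const.sub contDiff_fst).mul (hc 0)).add (contDiff_fst.mul (hc 1))),
      fun y => by simp [hGdef], fun y => by simp [hGdef], fun x hx y hy => ?_⟩
    have h1 := abs_le.1 (hA (0, y))
    have h2 := abs_le.1 (hA (1, y))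
    have h3 := abs_le.1 (hA (x, y))
    have hx0 := hx.1
    have hx1 : 0 ≤ 1 - x := sub_nonneg.2 hx.2
    simp only [hGdef]
    have h4 := mul_le_mul_of_nonneg_left h1.1 hx1
    have h5 := mul_le_mul_of_nonneg_left h1.2 hx1
    have h6 := mul_le_mul_of_nonneg_left h2.1 hx0
    have h7 := mul_le_mul_of_nonneg_left h2.2 hx0
    exact abs_le.2 (by constructor <;> linarith)
  have hder : ∀ p, fderiv ℝ φ p (1, 0) = fderiv ℝ G p (1, 0) + (φ (1, p.2) - φ (0, p.2)) :=
    fun p => by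
      have h1 := (hasDerivAt_fst hG.1 p.1 p.2).unique ((hasDerivAt_fst hφ p.1 p.2).sub
        ((((hasDerivAt_id' p.1).const_sub 1).mul_const (φ (0, p.2))).add
          ((hasDerivAt_id' p.1).mul_const (φ (1, p.2)))))
      rw [h1]
      ring
  obtain ⟨K, hK⟩ := exists_abs_fderiv_apply_le hφ hs (1, 0)
  have hd : ∀ p : ℝ × ℝ, |φ (1, p.2) - φ (0, p.2)| ≤ 2 * A := fun p =>
    (abs_sub _ _).trans (by linarith [hA (1, p.2), hA (0, p.2)])
  have i2 : Integrable (fun p : ℝ × ℝ => φ (1, p.2) - φ (0, p.2)) ν :=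
    integrable_of_abs_le ((hc 1).continuous.sub (hc 0).continuous).measurable hd
  have i1 : Integrable (fun p => fderiv ℝ G p (1, 0)) ν := by
    have : Integrable (fun p => fderiv ℝ φ p (1, 0)) ν :=
      integrable_of_abs_le (continuous_fderiv_apply_const hφ _).measurable hK
    refine (this.sub i2).congr (Eventually.of_forall fun p => ?_)
    simp [hder p]
  have b2 : |∫ p : ℝ × ℝ, (φ (1, p.2) - φ (0, p.2)) ∂ν| ≤ 2 * A := by
    have h : ∀ᵐ p : ℝ × ℝ ∂ν, ‖φ (1, p.2) - φ (0, p.2)‖ ≤ 2 * A := Eventually.of_forall hd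
    simpa using norm_integral_le_of_norm_le_const h
  simp_rw [hder]
  rw [integral_add i1 i2]
  have b1 := hS _ _ hG
  refine (abs_add_le _ _).trans ?_
  linarith

lemma exists_abs_integral_fderiv_pushed_le (ha : 4 < a) (hb : 2 < b) :
    ∃ C : ℝ, ∀ (n : ℕ) (φ : ℝ × ℝ → ℝ), ContDiff ℝ 1 φ → HasCompactSupport φ → (∀ p, |φ p| ≤ 1) →
      |∫ p, fderiv ℝ φ p (1, 0) ∂pushed a b n| ≤ C ∧
        |∫ p, fderiv ℝ φ p (0, 1) ∂pushed a b n| ≤ C := by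
  obtain ⟨S, -, hS⟩ := exists_fstVariationLe_pushed ha hb
  refine ⟨max ((2 * S + 2) * 1) ((2 + 4 * (|2 / b| / (1 - 2 / b))) * 1),
    fun n φ hφ hs hA => ⟨le_max_of_le_left ((hS n).abs_integral_fderiv_le hφ hs hA),
      le_max_of_le_right ?_⟩⟩
  rw [integral_pushed a b n (continuous_fderiv_apply_const hφ _).measurable]
  exact abs_integral_fderiv_snd_le hb n hφ hs hA

end Skew

/-! ### Limits of averages of uniformly bounded measures -/

lemma abs_integral_le_mul_norm {α : Type*} [MeasurableSpace α] {m ν : Measure α}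
    [IsProbabilityMeasure m] {K : ℝ≥0∞} (hK : K ≠ ⊤) (hle : ν ≤ K • m) (f : Lp ℝ 2 m) :
    |∫ x, f x ∂ν| ≤ K.toReal * ‖f‖ := by
  have h_int : Integrable f m := (Lp.memLp f).integrable one_le_two
  have h1 : ∫ x, ‖f x‖ ∂ν ≤ ∫ x, ‖f x‖ ∂(K • m) :=
    integral_mono_measure hle (Eventually.of_forall fun x => norm_nonneg _)
      (h_int.norm.smul_measure hK)
  have h2 : ∫ x, ‖f x‖ ∂m ≤ ‖f‖ := by
    rw [integral_norm_eq_lintegral_enorm h_int.aestronglyMeasurable, Lp.norm_def,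
      ← eLpNorm_one_eq_lintegral_enorm]
    exact ENNReal.toReal_mono (Lp.eLpNorm_ne_top f)
      (eLpNorm_le_eLpNorm_of_exponent_le one_le_two h_int.aestronglyMeasurable)
  rw [integral_smul_measure, smul_eq_mul] at h1
  exact (norm_integral_le_integral_norm _).trans
    (h1.trans (mul_le_mul_of_nonneg_left h2 ENNReal.toReal_nonneg))

/-- The average of the integrals of `g` against the first `n` measures of a sequence. -/
def averaged {α : Type*} [MeasurableSpace α] (ν : ℕ → Measure α) (n : ℕ) (g : α → ℝ) : ℝ :=
  (∑ i ∈ Finset.range n, ∫ x, g x ∂ν i) / n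

section averaged

variable {α : Type*} [MeasurableSpace α] {m : Measure α} {ν : ℕ → Measure α}

lemma averaged_congr (hν : ∀ i, ν i ≪ m) {f g : α → ℝ} (h : f =ᵐ[m] g) (n : ℕ) :
    averaged ν n f = averaged ν n g := by
  unfold averaged
  congr 1
  exact Finset.sum_congr rfl fun i _ => integral_congr_ae ((hν i).ae_le h)

lemma averaged_nonneg {g : α → ℝ} (hg : ∀ x, 0 ≤ g x) (n : ℕ) : 0 ≤ averaged ν n g :=
  div_nonneg (Finset.sum_nonneg fun _ _ => integral_nonneg hg) (Nat.cast_nonneg n)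

lemma abs_averaged_le {g : α → ℝ} {C : ℝ} (hC : 0 ≤ C) (h : ∀ i, |∫ x, g x ∂ν i| ≤ C) (n : ℕ) :
    |averaged ν n g| ≤ C := by
  rw [averaged, abs_div, Nat.abs_cast]
  refine div_le_of_le_mul₀ (Nat.cast_nonneg n) hC ((Finset.abs_sum_le_sum_abs _ _).trans ?_)
  simpa [mul_comm] using Finset.sum_le_card_nsmul (Finset.range n) _ C fun i _ => h i

lemma exists_tendsto_averaged {g : α → ℝ} {C : ℝ} (hC : 0 ≤ C) (h : ∀ i, |∫ x, g x ∂ν i| ≤ C) :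
    ∃ x, Tendsto (fun n => averaged ν n g) (hyperfilter ℕ) (𝓝 x) := by
  obtain ⟨x, -, hx⟩ := (isCompact_Icc (a := -C) (b := C)).ultrafilter_le_nhds
    ((hyperfilter ℕ).map fun n => averaged ν n g)
    (tendsto_principal.2 (Eventually.of_forall fun n => abs_le.1 (abs_averaged_le hC h n)))
  exact ⟨x, hx⟩

/-- Averages of probability measures with uniformly bounded densities converge, along an
ultrafilter, to a measure with a density. -/
lemma exists_limit_density [IsProbabilityMeasure m] {K : ℝ≥0∞} (hK : K ≠ ⊤)
    (hle : ∀ i, ν i ≤ K • m) :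
    ∃ h : α → ℝ, Measurable h ∧ Integrable h m ∧ (∀ x, 0 ≤ h x) ∧
      ∀ g : α → ℝ, Measurable g → ∀ C, (∀ x, |g x| ≤ C) →
        Tendsto (fun n => averaged ν n g) (hyperfilter ℕ) (𝓝 (∫ x, g x * h x ∂m)) := by
  have hac : ∀ i, ν i ≪ m := fun i => Measure.absolutelyContinuous_of_le_smul (hle i)
  have h_int : ∀ (f : Lp ℝ 2 m) i, Integrable f (ν i) := fun f i =>
    (((Lp.memLp f).integrable one_le_two).smul_measure hK).mono_measure (hle i)
  have hbd : ∀ (f : Lp ℝ 2 m) i, |∫ x, f x ∂ν i| ≤ K.toReal * ‖f‖ := fun f i =>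
    abs_integral_le_mul_norm hK (hle i) f
  have hbd0 : ∀ f : Lp ℝ 2 m, 0 ≤ K.toReal * ‖f‖ := fun f => by positivity
  choose Λ hΛ using fun f : Lp ℝ 2 m => exists_tendsto_averaged (hbd0 f) (hbd f)
  let L : Lp ℝ 2 m →ₗ[ℝ] ℝ :=
    { toFun := Λ
      map_add' := fun f g => by
        refine tendsto_nhds_unique (hΛ (f + g)) (((hΛ f).add (hΛ g)).congr fun n => ?_)
        rw [averaged_congr hac (Lp.coeFn_add f g), averaged, averaged, averaged, ← add_div,
          ← Finset.sum_add_distrib]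
        congr 1
        exact Finset.sum_congr rfl fun i _ => (integral_add (h_int f i) (h_int g i)).symm
      map_smul' := fun c f => by
        refine tendsto_nhds_unique (hΛ (c • f)) (((hΛ f).const_mul c).congr fun n => ?_)
        rw [averaged_congr hac (Lp.coeFn_smul c f), averaged, averaged, mul_div_assoc',
          Finset.mul_sum]
        congr 1
        exact Finset.sum_congr rfl fun i _ => (integral_const_mul c _).symm }
  have hL : ∀ f, ‖L f‖ ≤ K.toReal * ‖f‖ := fun f =>
    le_of_tendsto (hΛ f).abs (Eventually.of_forall (abs_averaged_le (hbd0 f) (hbd f)))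
  set k : Lp ℝ 2 m := (InnerProductSpace.toDual ℝ (Lp ℝ 2 m)).symm (L.mkContinuous _ hL) with hk
  have hkint : Integrable k m := (Lp.memLp k).integrable one_le_two
  have hlim : ∀ g : α → ℝ, Measurable g → ∀ C, (∀ x, |g x| ≤ C) →
      Tendsto (fun n => averaged ν n g) (hyperfilter ℕ) (𝓝 (∫ x, g x * k x ∂m)) := by
    intro g hg C hC
    have hgm : MemLp g 2 m := MemLp.of_bound hg.aestronglyMeasurable C (Eventually.of_forall hC)
    have h1 : Λ hgm.toLp = ∫ x, g x * k x ∂m := by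
      have h2 : inner ℝ k hgm.toLp = Λ hgm.toLp := by
        rw [hk, InnerProductSpace.toDual_symm_apply]; rfl
      rw [← h2, L2.inner_def]
      refine integral_congr_ae ?_
      filter_upwards [hgm.coeFn_toLp] with x hx
      simp [hx]
    rw [← h1]
    exact (hΛ _).congr fun n => averaged_congr hac hgm.coeFn_toLp n
  have hpos : 0 ≤ᵐ[m] k := by
    refine ae_nonneg_of_forall_setIntegral_nonneg hkint fun s hs _ => ?_
    have h1 := hlim (s.indicator 1) (measurable_one.indicator hs) 1 fun x => by
      by_cases hx : x ∈ s <;> simp [hx]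
    have h2 : ∫ x, s.indicator 1 x * k x ∂m = ∫ x in s, k x ∂m := by
      rw [← integral_indicator hs]
      congr 1 with x
      by_cases hx : x ∈ s <;> simp [hx]
    rw [← h2]
    exact ge_of_tendsto h1 (Eventually.of_forall fun n =>
      averaged_nonneg (fun x => indicator_nonneg (fun _ _ => zero_le_one) x) n)
  have hkm := hkint.aestronglyMeasurable.aemeasurable
  have hae : (fun x => max (hkm.mk k x) 0) =ᵐ[m] k := by
    filter_upwards [hkm.ae_eq_mk, hpos] with x h1 h2
    rw [← h1]
    exact max_eq_left h2
  refine ⟨fun x => max (hkm.mk k x) 0, hkm.measurable_mk.max measurable_const,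
    hkint.congr hae.symm, fun x => le_max_right _ _, fun g hg C hC => ?_⟩
  have : ∫ x, g x * max (hkm.mk k x) 0 ∂m = ∫ x, g x * k x ∂m :=
    integral_congr_ae (hae.mono fun x hx => by dsimp only at hx ⊢; rw [hx])
  rw [this]
  exact hlim g hg C hC

end averaged

/-- `skew a b` has an invariant probability density of bounded variation on the unit square. -/
lemma exists_invariant_density {a b : ℝ} (ha : 4 < a) (hb : 2 < b) :
    ∃ h : ℝ × ℝ → ℝ, Measurable h ∧ Integrable h unitSq ∧ (∀ p, 0 ≤ h p) ∧
      ∫ p, h p ∂unitSq = 1 ∧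
      (∀ B, MeasurableSet B → ∫ p in skew a b ⁻¹' B, h p ∂unitSq = ∫ p in B, h p ∂unitSq) ∧
      ∃ C : ℝ, ∀ φ : ℝ × ℝ → ℝ, ContDiff ℝ 1 φ → HasCompactSupport φ → (∀ p, |φ p| ≤ 1) →
        |∫ p, fderiv ℝ φ p (1, 0) * h p ∂unitSq| ≤ C ∧
          |∫ p, fderiv ℝ φ p (0, 1) * h p ∂unitSq| ≤ C := by
  obtain ⟨K, hK, hle⟩ := exists_map_skew_iterate_le ha hb
  obtain ⟨h, hm, hi, h0, hlim⟩ := exists_limit_density (ν := pushed a b) hK hle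
  have hT := measurable_skew a b
  have hne : ∀ᶠ n : ℕ in hyperfilter ℕ, n ≠ 0 := Nat.hyperfilter_le_atTop (eventually_ne_atTop 0)
  have hind : ∀ B, MeasurableSet B → Tendsto (fun n => averaged (pushed a b) n (B.indicator 1))
      (hyperfilter ℕ) (𝓝 (∫ p in B, h p ∂unitSq)) := fun B hB => by
    have h1 := hlim (B.indicator 1) (measurable_one.indicator hB) 1 fun x => by
      by_cases hx : x ∈ B <;> simp [hx]
    have h2 : ∫ p, B.indicator 1 p * h p ∂unitSq = ∫ p in B, h p ∂unitSq := by
      rw [← integral_indicator hB]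
      congr 1 with x
      by_cases hx : x ∈ B <;> simp [hx]
    rwa [h2] at h1
  refine ⟨h, hm, hi, h0, ?_, fun B hB => ?_, ?_⟩
  · have h1 := hlim (fun _ => 1) measurable_const 1 (by simp)
    simp only [one_mul] at h1
    refine tendsto_nhds_unique h1 (tendsto_const_nhds.congr' ?_)
    filter_upwards [hne] with n hn
    simp [averaged, hn]
  · have h1 := (hind _ (hT hB)).sub (hind B hB)
    have hr : ∀ i, ∫ p, (skew a b ⁻¹' B).indicator 1 p ∂pushed a b i
        = (pushed a b (i + 1)).real B := fun i => by
      rw [integral_indicator_one (hT hB), pushed_succ, map_measureReal_apply hT hB]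
    have hd : ∀ n, averaged (pushed a b) n ((skew a b ⁻¹' B).indicator 1)
        - averaged (pushed a b) n (B.indicator 1)
        = ((pushed a b n).real B - (pushed a b 0).real B) / n := fun n => by
      rw [averaged, averaged, ← sub_div, ← Finset.sum_sub_distrib]
      simp_rw [hr, integral_indicator_one hB]
      rw [Finset.sum_range_sub fun i => (pushed a b i).real B]
    simp_rw [hd] at h1
    have hz : Tendsto (fun n : ℕ => ((pushed a b n).real B - (pushed a b 0).real B) / n)
        (hyperfilter ℕ) (𝓝 0) := by
      have hq : Tendsto (fun n : ℕ => 1 / (n : ℝ)) (hyperfilter ℕ) (𝓝 0) :=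
        tendsto_one_div_atTop_nhds_zero_nat.mono_left Nat.hyperfilter_le_atTop
      refine squeeze_zero_norm (fun n => ?_) hq
      rw [norm_div, Real.norm_natCast]
      refine div_le_div_of_nonneg_right (abs_le.2 ⟨?_, ?_⟩) (Nat.cast_nonneg n)
      · linarith [measureReal_nonneg (μ := pushed a b n) (s := B),
          measureReal_le_one (μ := pushed a b 0) (s := B)]
      · linarith [measureReal_nonneg (μ := pushed a b 0) (s := B),
          measureReal_le_one (μ := pushed a b n) (s := B)]
    exact sub_eq_zero.1 (tendsto_nhds_unique h1 hz)
  · obtain ⟨C, hC⟩ := exists_abs_integral_fderiv_pushed_le ha hb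
    refine ⟨C, fun φ hφ hs hA => ?_⟩
    have key : ∀ v, (∀ n, |∫ p, fderiv ℝ φ p v ∂pushed a b n| ≤ C) →
        |∫ p, fderiv ℝ φ p v * h p ∂unitSq| ≤ C := fun v hv => by
      obtain ⟨B, hB⟩ := exists_abs_fderiv_apply_le hφ hs v
      exact le_of_tendsto (hlim _ (continuous_fderiv_apply_const hφ v).measurable B hB).abs
        (Eventually.of_forall (abs_averaged_le ((abs_nonneg _).trans (hv 0)) hv))
    exact ⟨key _ fun n => (hC n φ hφ hs hA).1, key _ fun n => (hC n φ hφ hs hA).2⟩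

/-! ### Transfer to `Fin 2 → ℝ` -/

/-- The two coordinates of a point of `Fin 2 → ℝ`, as a pair. -/
def toPair (q : Fin 2 → ℝ) : ℝ × ℝ := (q 0, q 1)

/-- The point of `Fin 2 → ℝ` with given coordinates. -/
def ofPair : (ℝ × ℝ) ≃L[ℝ] (Fin 2 → ℝ) := (ContinuousLinearEquiv.finTwoArrow ℝ ℝ).symm

lemma ofPair_apply (p : ℝ × ℝ) : ofPair p = ![p.1, p.2] := rfl

lemma ofPair_toPair (q : Fin 2 → ℝ) : ofPair (toPair q) = q := by
  ext i; fin_cases i <;> rfl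

lemma measurePreserving_toPair : MeasurePreserving toPair volume volume :=
  volume_preserving_finTwoArrow ℝ

lemma measurableEmbedding_toPair : MeasurableEmbedding toPair :=
  (MeasurableEquiv.finTwoArrow (α := ℝ)).measurableEmbedding

lemma exT_ofPair (a b : ℝ) (p : ℝ × ℝ) : exT a b (ofPair p) = ofPair (skew a b p) := rfl

lemma measurableSet_eq_intCast {α : Type*} [MeasurableSpace α] {f : α → ℝ} (hf : Measurable f) :
    MeasurableSet {x | ∃ k : ℤ, f x = k} := by
  have : {x | ∃ k : ℤ, f x = k} = f ⁻¹' range ((↑) : ℤ → ℝ) := by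
    ext x; simp [eq_comm]
  rw [this]
  exact hf (countable_range _).measurableSet

lemma measurableSet_exOmega (a b : ℝ) : MeasurableSet (exOmega a b) := by
  refine (measurableSet_Ioo.preimage (measurable_pi_apply 0)).inter
    ((measurableSet_Ioo.preimage (measurable_pi_apply 1)).inter
      ((measurableSet_eq_intCast ?_).compl.inter (measurableSet_eq_intCast ?_).compl))
  all_goals fun_prop

/-- The preimage of the integers under a non-constant affine map is countable. -/
lemma countable_setOf_mul_add_eq_intCast {c : ℝ} (hc : c ≠ 0) (d : ℝ) :
    {y : ℝ | ∃ k : ℤ, c * y + d = k}.Countable := by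
  refine (countable_range fun k : ℤ => ((k : ℝ) - d) / c).mono ?_
  rintro y ⟨k, hk⟩
  exact ⟨k, by simp only [← hk]; field_simp; ring⟩

lemma exOmega_ae_eq {a b : ℝ} (ha : a ≠ 0) (hb : b ≠ 0) :
    exOmega a b =ᵐ[volume] toPair ⁻¹' (Ioo (0:ℝ) 1 ×ˢ Ioo (0:ℝ) 1) := by
  set s : Set (ℝ × ℝ) := {p | 0 < p.1} ∩
    ({p | ∃ k : ℤ, a * √p.1 = k} ∪ {p | ∃ k : ℤ, b * p.2 + √p.1 = k}) with hs
  have hsm : MeasurableSet s := (measurableSet_lt measurable_const measurable_fst).inter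
    ((measurableSet_eq_intCast (by fun_prop)).union (measurableSet_eq_intCast (by fun_prop)))
  have hs0 : volume s = 0 := by
    rw [Measure.volume_eq_prod, Measure.measure_prod_null hsm]
    have hc : {x : ℝ | 0 < x ∧ ∃ k : ℤ, a * √x = k}.Countable := by
      refine ((countable_setOf_mul_add_eq_intCast ha 0).image fun t => t ^ 2).mono ?_
      rintro x ⟨hx, k, hk⟩
      exact ⟨√x, ⟨k, by rw [add_zero, hk]⟩, Real.sq_sqrt hx.le⟩
    filter_upwards [hc.ae_notMem volume] with x hx
    refine measure_mono_null (fun y hy => ?_)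
      ((countable_setOf_mul_add_eq_intCast hb (√x)).measure_zero volume)
    exact hy.2.resolve_left fun h => hx ⟨hy.1, h⟩
  have hs1 : ∀ᵐ q, toPair q ∉ s := by
    have : ∀ᵐ p : ℝ × ℝ, p ∉ s := measure_eq_zero_iff_ae_notMem.1 hs0
    exact measurePreserving_toPair.quasiMeasurePreserving.ae this
  filter_upwards [hs1] with q hq
  refine propext ⟨fun h => ⟨h.1, h.2.1⟩, fun h => ⟨h.1, h.2, fun hk => hq ?_, fun hk => hq ?_⟩⟩
  · exact ⟨h.1.1, Or.inl hk⟩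
  · exact ⟨h.1.1, Or.inr hk⟩

section

variable {a b : ℝ} {h : ℝ × ℝ → ℝ}

/-- A function on the plane, transferred to `Fin 2 → ℝ` and restricted to the domain. -/
def extendDensity (a b : ℝ) (h : ℝ × ℝ → ℝ) : (Fin 2 → ℝ) → ℝ :=
  (exOmega a b).indicator fun q => h (toPair q)

lemma integrable_extendDensity (ha : a ≠ 0) (hb : b ≠ 0) (hi : Integrable h unitSq) :
    Integrable (extendDensity a b h) := by
  rw [extendDensity, integrable_indicator_iff (measurableSet_exOmega a b),
    integrableOn_congr_set_ae (exOmega_ae_eq ha hb)]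
  rw [unitSq_eq_restrict] at hi
  exact (measurePreserving_toPair.integrableOn_comp_preimage measurableEmbedding_toPair).2 hi

lemma integral_extendDensity_mul (ha : a ≠ 0) (hb : b ≠ 0) (g : ℝ × ℝ → ℝ) :
    ∫ q, extendDensity a b h q * g (toPair q) = ∫ p, g p * h p ∂unitSq := by
  have h1 : ∀ q, extendDensity a b h q * g (toPair q)
      = (exOmega a b).indicator (fun q => g (toPair q) * h (toPair q)) q := fun q => by
    by_cases hq : q ∈ exOmega a b <;> simp [extendDensity, hq, mul_comm]
  simp_rw [h1]
  rw [integral_indicator (measurableSet_exOmega a b), setIntegral_congr_set (exOmega_ae_eq ha hb),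
    unitSq_eq_restrict]
  exact measurePreserving_toPair.setIntegral_preimage_emb measurableEmbedding_toPair
    (fun p => g p * h p) _

lemma isDensity_extendDensity (ha : a ≠ 0) (hb : b ≠ 0) :
    IsDensity ((unitSq.withDensity fun p => ENNReal.ofReal (h p)).map ofPair)
      (extendDensity a b h) := by
  intro A hA
  have hof : Measurable ofPair := ofPair.continuous.measurable
  have hΩ := measurableSet_exOmega a b
  have h1 : ∀ q, ENNReal.ofReal (extendDensity a b h q)
      = (exOmega a b).indicator (fun q => ENNReal.ofReal (h (toPair q))) q := fun q => by
    by_cases hq : q ∈ exOmega a b <;> simp [extendDensity, hq]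
  have h2 : toPair ⁻¹' (ofPair ⁻¹' A ∩ Ioo (0:ℝ) 1 ×ˢ Ioo (0:ℝ) 1)
      = toPair ⁻¹' (Ioo (0:ℝ) 1 ×ˢ Ioo (0:ℝ) 1) ∩ A := by
    ext q; simp only [mem_preimage, mem_inter_iff, ofPair_toPair, and_comm]
  rw [Measure.map_apply hof hA, withDensity_apply _ (hof hA), unitSq_eq_restrict,
    Measure.restrict_restrict (hof hA),
    ← measurePreserving_toPair.setLIntegral_comp_preimage_emb measurableEmbedding_toPair, h2]
  simp_rw [h1]
  rw [lintegral_indicator hΩ, Measure.restrict_restrict hΩ]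
  exact setLIntegral_congr ((exOmega_ae_eq ha hb).symm.inter (ae_eq_refl A))

lemma IsDensity.absolutelyContinuous {d : ℕ} {μ : Measure (Fin d → ℝ)} {f : (Fin d → ℝ) → ℝ}
    (hf : IsDensity μ f) : μ ≪ volume := by
  refine Measure.AbsolutelyContinuous.mk fun A hA h0 => ?_
  rw [hf A hA, Measure.restrict_eq_zero.2 h0, lintegral_zero_measure]

lemma invariantMeasure_map_ofPair (ha : a ≠ 0) (hb : b ≠ 0) (hi : Integrable h unitSq)
    (h0 : ∀ p, 0 ≤ h p) (h1 : ∫ p, h p ∂unitSq = 1)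
    (hinv : ∀ B, MeasurableSet B →
      ∫ p in skew a b ⁻¹' B, h p ∂unitSq = ∫ p in B, h p ∂unitSq) :
    InvariantMeasure (exOmega a b) (exT a b)
      ((unitSq.withDensity fun p => ENNReal.ofReal (h p)).map ofPair) := by
  have hof : Measurable ofPair := ofPair.continuous.measurable
  have hT := measurable_skew a b
  have hd := isDensity_extendDensity (h := h) ha hb
  have hval : ∀ B, MeasurableSet B → (unitSq.withDensity fun p => ENNReal.ofReal (h p)) B
      = ENNReal.ofReal (∫ p in B, h p ∂unitSq) := fun B hB => by
    rw [withDensity_apply _ hB,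
      ofReal_integral_eq_lintegral_ofReal hi.integrableOn (Eventually.of_forall h0)]
  refine ⟨⟨?_⟩, hd.absolutelyContinuous, ?_, fun A hA => ?_⟩
  · rw [Measure.map_apply hof MeasurableSet.univ, preimage_univ, hval _ MeasurableSet.univ,
      setIntegral_univ, h1, ENNReal.ofReal_one]
  · rw [hd _ (measurableSet_exOmega a b).compl,
      setLIntegral_congr_fun (measurableSet_exOmega a b).compl (g := 0) fun q hq => by
        simp [extendDensity, indicator_of_notMem hq]]
    simp
  · have hexT : Measurable (exT a b) := by
      have : exT a b = ofPair ∘ skew a b ∘ toPair := by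
        ext q; rw [Function.comp, Function.comp, ← exT_ofPair, ofPair_toPair]
      rw [this]
      exact hof.comp (hT.comp measurePreserving_toPair.measurable)
    have hpre : ofPair ⁻¹' (exT a b ⁻¹' A) = skew a b ⁻¹' (ofPair ⁻¹' A) := by
      ext p; rw [mem_preimage, mem_preimage, exT_ofPair]; rfl
    rw [Measure.map_apply hof (hexT hA), Measure.map_apply hof hA, hpre, hval _ (hT (hof hA)),
      hval _ (hof hA), hinv _ (hof hA)]

/-- The `i`-th component of a test vector field, as a function on the plane. -/
def component (φ : (Fin 2 → ℝ) → (Fin 2 → ℝ)) (i : Fin 2) (p : ℝ × ℝ) : ℝ := φ (ofPair p) i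

lemma fderiv_component {φ : (Fin 2 → ℝ) → (Fin 2 → ℝ)} (hφ : ContDiff ℝ 1 φ) (i : Fin 2)
    (p v : ℝ × ℝ) : fderiv ℝ (component φ i) p v = fderiv ℝ φ (ofPair p) (ofPair v) i := by
  have h1 := (hφ.differentiable one_ne_zero).differentiableAt.hasFDerivAt (x := ofPair p)
  have h2 := hasFDerivAt_pi'.1 (h1.comp p ofPair.hasFDerivAt) i
  rw [show component φ i = fun p => (φ ∘ ofPair) p i from rfl, h2.fderiv]
  rfl

lemma IsTest.component {φ : (Fin 2 → ℝ) → (Fin 2 → ℝ)} (hφ : IsTest 2 φ) (i : Fin 2) :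
    ContDiff ℝ 1 (component φ i) ∧ HasCompactSupport (component φ i) ∧
      ∀ p, |Liverani.component φ i p| ≤ 1 :=
  ⟨contDiff_pi.1 (hφ.1.comp ofPair.contDiff) i,
    (hφ.2.1.comp_homeomorph ofPair.toHomeomorph).comp_left (g := fun w : Fin 2 → ℝ => w i) rfl,
    fun p => (norm_le_pi_norm (φ (ofPair p)) i).trans (hφ.2.2 _)⟩

lemma divg_eq {φ : (Fin 2 → ℝ) → (Fin 2 → ℝ)} (hφ : ContDiff ℝ 1 φ) (q : Fin 2 → ℝ) :
    divg φ q = fderiv ℝ (component φ 0) (toPair q) (1, 0)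
      + fderiv ℝ (component φ 1) (toPair q) (0, 1) := by
  have e0 : (Pi.single 0 1 : Fin 2 → ℝ) = ofPair (1, 0) := by
    ext i; fin_cases i <;> simp [ofPair_apply]
  have e1 : (Pi.single 1 1 : Fin 2 → ℝ) = ofPair (0, 1) := by
    ext i; fin_cases i <;> simp [ofPair_apply]
  rw [divg, Fin.sum_univ_two, fderiv_component hφ, fderiv_component hφ, ofPair_toPair, e0, e1]

lemma memBVOn_extendDensity (ha : a ≠ 0) (hb : b ≠ 0) (hi : Integrable h unitSq) {C : ℝ}
    (hC : ∀ φ : ℝ × ℝ → ℝ, ContDiff ℝ 1 φ → HasCompactSupport φ → (∀ p, |φ p| ≤ 1) →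
      |∫ p, fderiv ℝ φ p (1, 0) * h p ∂unitSq| ≤ C ∧
        |∫ p, fderiv ℝ φ p (0, 1) * h p ∂unitSq| ≤ C) :
    MemBVOn (exOmega a b) (extendDensity a b h) := by
  have hind : (exOmega a b).indicator (extendDensity a b h) = extendDensity a b h := by
    rw [extendDensity, indicator_indicator, inter_self]
  rw [MemBVOn, hind]
  refine ⟨integrable_extendDensity ha hb hi, lt_of_le_of_lt (iSup_le ?_)
    (ENNReal.ofReal_lt_top (r := C + C))⟩
  rintro ⟨φ, hφ⟩
  refine ENNReal.ofReal_le_ofReal ?_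
  obtain ⟨hc0, hs0, hA0⟩ := hφ.component 0
  obtain ⟨hc1, hs1, hA1⟩ := hφ.component 1
  have hbdd : ∀ {f : ℝ × ℝ → ℝ}, ContDiff ℝ 1 f → HasCompactSupport f → ∀ v,
      Integrable (fun p => fderiv ℝ f p v * h p) unitSq := fun hf hs v => by
    obtain ⟨B, hB⟩ := exists_abs_fderiv_apply_le hf hs v
    exact hi.bdd_mul (continuous_fderiv_apply_const hf v).aestronglyMeasurable
      (Eventually.of_forall hB)
  simp_rw [divg_eq hφ.1]
  rw [integral_extendDensity_mul ha hb fun p => fderiv ℝ (component φ 0) p (1, 0)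
    + fderiv ℝ (component φ 1) p (0, 1)]
  simp_rw [add_mul]
  rw [integral_add (hbdd hc0 hs0 _) (hbdd hc1 hs1 _)]
  exact add_le_add ((le_abs_self _).trans (hC _ hc0 hs0 hA0).1)
    ((le_abs_self _).trans (hC _ hc1 hs1 hA1).2)

end

theorem statement18 (a b : ℝ) (ha : 6 < a) (hb : 6 < b) :
    ∃ μ : Measure (Fin 2 → ℝ), InvariantMeasure (exOmega a b) (exT a b) μ ∧
      ∃ h : (Fin 2 → ℝ) → ℝ, IsDensity μ h ∧ MemBVOn (exOmega a b) h := by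
  have ha0 : a ≠ 0 := by linarith
  have hb0 : b ≠ 0 := by linarith
  obtain ⟨h, -, hi, h0, h1, hinv, C, hC⟩ :=
    exists_invariant_density (a := a) (b := b) (by linarith) (by linarith)
  exact ⟨_, invariantMeasure_map_ofPair ha0 hb0 hi h0 h1 hinv, extendDensity a b h,
    isDensity_extendDensity ha0 hb0, memBVOn_extendDensity ha0 hb0 hi hC⟩

end Liverani
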